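/- Define S₀ to be the set of pairs (a, p) of integers consisting of all pairs (−p, p) with p prime and 7 ≤ p ≤ 100000, together with the pairs (−43,7), (−127,7), (−547,7), (−683,11), (−1093,7), (−2047,11), (−2731,13), (−3277,7), (−5461,7), (−8191,11), (−13021,7), (−19531,7), (−39991,7), (−43691,17), (−44287,11), (−55987,7), (−88573,11). There exists a positive integer n₀ such that for all integers n ≥ n₀ and b ≥ 2 and every pair (a, p) ∈ S₀, if n! = (b^p − 1)/(b − 1) + a, then |a| ≥ 0.5·(log log log n)/(log log log log n). -/

import Mathlib

/-- The exceptional set `S₀` of pairs `(a, p)`. -/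
def S₀ : Set (ℤ × ℕ) :=
  {x | ∃ p : ℕ, Nat.Prime p ∧ 7 ≤ p ∧ p ≤ 100000 ∧ x = (-(p : ℤ), p)} ∪
  {(-43, 7), (-127, 7), (-547, 7), (-683, 11), (-1093, 7), (-2047, 11),
   (-2731, 13), (-3277, 7), (-5461, 7), (-8191, 11), (-13021, 7), (-19531, 7),
   (-39991, 7), (-43691, 17), (-44287, 11), (-55987, 7), (-88573, 11)}

section MertensSums

open Filter Topology Finset

theorem exists_abs_sub_le_of_tendsto_div {A : ℕ → ℝ} {κ : ℝ}
    (hA : Tendsto (fun n : ℕ => A n / n) atTop (𝓝 κ)) {ε : ℝ} (hε : 0 < ε) :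
    ∃ C : ℝ, 0 ≤ C ∧ ∀ n : ℕ, |A n - κ * n| ≤ ε * n + C := by
  obtain ⟨N, hN⟩ := Metric.tendsto_atTop.mp hA ε hε
  refine ⟨∑ n ∈ range (N + 1), |A n - κ * n|, sum_nonneg fun _ _ => abs_nonneg _, fun n => ?_⟩
  by_cases hn : n ∈ range (N + 1)
  · have := single_le_sum (f := fun n : ℕ => |A n - κ * n|) (fun _ _ => abs_nonneg _) hn
    have h2 : 0 ≤ ε * n := by positivity
    linarith
  · have hn' : N + 1 ≤ n := by simpa using hn
    have h0 : (0 : ℝ) < n := by exact_mod_cast (by omega : 0 < n)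
    have h1 := hN n (by omega)
    rw [Real.dist_eq] at h1
    have h2 : A n - κ * n = (A n / n - κ) * n := by field_simp
    have h3 : 0 ≤ ∑ n ∈ range (N + 1), |A n - κ * n| := sum_nonneg fun _ _ => abs_nonneg _
    rw [h2, abs_mul, abs_of_pos h0]
    nlinarith

theorem sum_log_primesLE_le (n : ℕ) : ∑ l ∈ n.primesLE, Real.log l ≤ 2 * n := by
  rw [← Chebyshev.theta_eq_sum_primesLE_log]
  refine (Chebyshev.theta_le_log4_mul_x n.cast_nonneg).trans ?_
  have : Real.log 4 ≤ 2 := by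
    have : Real.log 4 = 2 * Real.log 2 := by
      rw [show (4 : ℝ) = 2 ^ 2 by norm_num, Real.log_pow]; norm_num
    have := Real.log_two_lt_d9
    linarith
  gcongr

theorem mul_log_sub_le_sum_mul_log {c : ℕ → ℝ} (hc : ∀ m, 0 ≤ c m) {C : ℝ}
    (hC : ∀ n : ℕ, ∑ m ∈ Icc 1 n, c m ≤ C * n) (n : ℕ) :
    (∑ m ∈ Icc 1 n, c m) * Real.log n - C * n ≤ ∑ m ∈ Icc 1 n, c m * Real.log m := by
  induction n with
  | zero => simp
  | succ n ih =>
    rw [sum_Icc_succ_top (by omega), sum_Icc_succ_top (by omega)]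
    rcases Nat.eq_zero_or_pos n with rfl | hn
    · have := (sum_nonneg fun m _ => hc m).trans (hC 1)
      simpa using this
    · have hn' : (0 : ℝ) < n := by exact_mod_cast hn
      have h1 : Real.log (n + 1 : ℕ) - Real.log n ≤ 1 / n := by
        rw [← Real.log_div (by positivity) (by positivity)]
        refine (Real.log_le_sub_one_of_pos (by positivity)).trans_eq ?_
        push_cast; field_simp; ring
      have h2 : (∑ m ∈ Icc 1 n, c m) * (Real.log (n + 1 : ℕ) - Real.log n) ≤ C :=
        calc _ ≤ (∑ m ∈ Icc 1 n, c m) * (1 / n) :=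
              mul_le_mul_of_nonneg_left h1 (sum_nonneg fun m _ => hc m)
          _ ≤ (C * n) * (1 / n) := by gcongr; exact hC n
          _ = C := by field_simp
      push_cast at *
      nlinarith

theorem sum_mul_log_le {c : ℕ → ℝ} (hc : ∀ m, 0 ≤ c m) (n : ℕ) :
    ∑ m ∈ Icc 1 n, c m * Real.log m ≤ (∑ m ∈ Icc 1 n, c m) * Real.log n := by
  rw [sum_mul]
  refine sum_le_sum fun m hm => mul_le_mul_of_nonneg_left ?_ (hc m)
  rw [mem_Icc] at hm
  have : (0 : ℝ) < m := by exact_mod_cast hm.1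
  have : (m : ℝ) ≤ n := by exact_mod_cast hm.2
  gcongr

/-- The partial sums `∑ a(l) log l / l` over primes `l ≤ n`. -/
noncomputable def mertensSum (a : ℕ → ℝ) (n : ℕ) : ℝ :=
  ∑ l ∈ n.primesLE, a l * Real.log l / l

theorem mertensSum_nonneg {a : ℕ → ℝ} (ha : ∀ l, 0 ≤ a l) (n : ℕ) : 0 ≤ mertensSum a n :=
  sum_nonneg fun l _ => div_nonneg (mul_nonneg (ha l) (Real.log_natCast_nonneg l)) l.cast_nonneg

theorem abs_sum_sub_mertensSum_le {a A : ℕ → ℝ} {D κ ε C : ℝ} (ha : ∀ l, 0 ≤ a l)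
    (haD : ∀ l, l.Prime → a l ≤ D) (hκ : 0 ≤ κ) (hC : 0 ≤ C) (hε : 0 ≤ ε)
    (hA : ∀ n : ℕ, |A n - κ * n| ≤ ε * n + C) (n : ℕ) :
    |∑ l ∈ n.primesLE, a l * Real.log l * A (n / l) - κ * n * mertensSum a n| ≤
      ε * n * mertensSum a n + 2 * D * (C + κ) * n := by
  have hD : 0 ≤ D := (ha 2).trans (haD 2 Nat.prime_two)
  have key : ∀ l ∈ n.primesLE,
      |a l * Real.log l * A (n / l) - κ * n * (a l * Real.log l / l)| ≤
        ε * n * (a l * Real.log l / l) + D * (C + κ) * Real.log l := by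
    intro l hl
    have hl0 : (0 : ℝ) < l := by exact_mod_cast (Nat.prime_of_mem_primesLE hl).pos
    have hlog := Real.log_natCast_nonneg l
    have hfloor : ((n / l : ℕ) : ℝ) ≤ n / l := Nat.cast_div_le
    have hfloor' : (n : ℝ) / l - 1 ≤ (n / l : ℕ) := by
      have := Nat.lt_floor_add_one ((n : ℝ) / l)
      rw [Nat.floor_div_eq_div] at this
      linarith
    have h1 : |A (n / l) - κ * (n / l)| ≤ ε * (n / l) + (C + κ) := by
      have h2 := hA (n / l)
      have h3 : |κ * (n / l : ℕ) - κ * (n / l)| ≤ κ := by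
        rw [← mul_sub, abs_mul, abs_of_nonneg hκ]
        refine mul_le_of_le_one_right hκ ?_
        rw [abs_le]; constructor <;> linarith
      have h4 := abs_sub_le (A (n / l)) (κ * (n / l : ℕ)) (κ * (n / l))
      have h5 : ε * (n / l : ℕ) ≤ ε * (n / l) := by gcongr
      linarith
    have h6 : a l * Real.log l * A (n / l) - κ * n * (a l * Real.log l / l) =
        a l * Real.log l * (A (n / l) - κ * (n / l)) := by ring
    have h7 : 0 ≤ a l * Real.log l := mul_nonneg (ha l) hlog
    rw [h6, abs_mul, abs_of_nonneg h7]
    calc _ ≤ a l * Real.log l * (ε * (n / l) + (C + κ)) := by gcongr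
      _ = ε * n * (a l * Real.log l / l) + a l * (C + κ) * Real.log l := by ring
      _ ≤ _ := by gcongr; exact haD l (Nat.prime_of_mem_primesLE hl)
  have h8 := sum_log_primesLE_le n
  unfold mertensSum
  rw [mul_sum, mul_sum, ← sum_sub_distrib]
  refine (abs_sum_le_sum_abs _ _).trans ((sum_le_sum key).trans ?_)
  rw [sum_add_distrib, ← mul_sum (f := fun l : ℕ => Real.log l)]
  have h9 : 0 ≤ D * (C + κ) := by positivity
  nlinarith

/-- A Mertens-type theorem: if `c` has mean value `κ > 0` and `∑ c(m) log m` is, up to `O(n)`, the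
sum of `a(l) log l ∑_{m ≤ n / l} c(m)` over the primes `l ≤ n`, then `∑ a(l) log l / l` is
asymptotic to `log n`. -/
theorem mertensSum_asymptotic {a c : ℕ → ℝ} {D κ E : ℝ} (ha : ∀ l, 0 ≤ a l)
    (haD : ∀ l, l.Prime → a l ≤ D) (hκ : 0 < κ) (hc : ∀ m, 0 ≤ c m)
    (hcκ : Tendsto (fun n : ℕ => (∑ m ∈ Icc 1 n, c m) / n) atTop (𝓝 κ))
    (h1 : ∀ n : ℕ, ∑ l ∈ n.primesLE, a l * Real.log l * ∑ m ∈ Icc 1 (n / l), c m ≤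
      ∑ m ∈ Icc 1 n, c m * Real.log m)
    (h2 : ∀ n : ℕ, ∑ m ∈ Icc 1 n, c m * Real.log m ≤
      ∑ l ∈ n.primesLE, a l * Real.log l * ∑ m ∈ Icc 1 (n / l), c m + E * n)
    {δ : ℝ} (hδ : 0 < δ) :
    ∀ᶠ n : ℕ in atTop, (1 - δ) * Real.log n ≤ mertensSum a n ∧
      mertensSum a n ≤ (1 + δ) * Real.log n := by
  set t : ℝ := δ / (2 + δ) with ht
  have ht0 : 0 < t := by positivity
  have ht1 : t < 1 := by rw [ht, div_lt_one (by positivity)]; linarith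
  have hε : 0 < κ * t := by positivity
  obtain ⟨C, hC0, hC⟩ := exists_abs_sub_le_of_tendsto_div hcκ hε
  obtain ⟨C', hC'0, hC'⟩ := exists_abs_sub_le_of_tendsto_div hcκ (half_pos hε)
  have hA : ∀ n : ℕ, ∑ m ∈ Icc 1 n, c m ≤ (κ + κ * t + C) * n := by
    intro n
    rcases Nat.eq_zero_or_pos n with rfl | hn
    · simp
    · have := (abs_le.mp (hC n)).2
      have hn' : (1 : ℝ) ≤ n := by exact_mod_cast hn
      nlinarith
  set B : ℝ := C' + |E| + (κ + κ * t + C) + 2 * D * (C + κ)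
  have hlog : Tendsto (fun n : ℕ => Real.log n) atTop atTop :=
    Real.tendsto_log_atTop.comp tendsto_natCast_atTop_atTop
  filter_upwards [eventually_ge_atTop 1, hlog.eventually_ge_atTop (B / (κ * t / 2))] with n hn hB
  set L := Real.log n
  set W := mertensSum a n
  have hn0 : (0 : ℝ) < n := by exact_mod_cast hn
  have hL0 : 0 ≤ L := Real.log_natCast_nonneg n
  have hLn : L ≤ n := (Real.log_le_sub_one_of_pos hn0).trans (by linarith)
  have hW0 : 0 ≤ W := mertensSum_nonneg ha n
  have hBL : B * n ≤ κ * t / 2 * L * n := by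
    rw [div_le_iff₀' (by positivity)] at hB
    gcongr
  have hM := abs_le.mp (abs_sum_sub_mertensSum_le ha haD hκ.le hC0 hε.le hC n)
  have hAn := abs_le.mp (hC' n)
  have hSu := sum_mul_log_le hc n
  have hSl := mul_log_sub_le_sum_mul_log hc hA n
  have hE : E * n ≤ |E| * n := by gcongr; exact le_abs_self E
  have hup : (∑ m ∈ Icc 1 n, c m) * L ≤ (κ * n + κ * t / 2 * n + C') * L := by gcongr; linarith
  have hlo : (κ * n - κ * t / 2 * n - C') * L ≤ (∑ m ∈ Icc 1 n, c m) * L := by gcongr; linarith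
  have hCL : C' * L ≤ C' * n := by gcongr
  have hBn : B * n = C' * n + |E| * n + (κ + κ * t + C) * n + 2 * D * (C + κ) * n := by
    simp only [B]; ring
  have hp1 : 0 ≤ |E| * n := by positivity
  have hp2 : 0 ≤ (κ + κ * t + C) * n := by positivity
  have hupper : (κ * n) * ((1 - t) * W) ≤ (κ * n) * ((1 + t) * L) := by
    linarith [h1 n, hM.1]
  have hlower : (κ * n) * ((1 - t) * L) ≤ (κ * n) * ((1 + t) * W) := by
    linarith [h2 n, hM.2]
  have hκn : 0 < κ * n := by positivity
  replace hupper := le_of_mul_le_mul_left hupper hκn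
  replace hlower := le_of_mul_le_mul_left hlower hκn
  have e1 : (1 - t) = 2 / (2 + δ) := by rw [ht]; field_simp; ring
  have e2 : (1 + t) = 2 * (1 + δ) / (2 + δ) := by rw [ht]; field_simp; ring
  rw [e1, e2, div_mul_eq_mul_div, div_mul_eq_mul_div, div_le_div_iff_of_pos_right (by positivity)]
    at hupper hlower
  constructor <;> nlinarith [mul_nonneg (mul_nonneg hδ.le hδ.le) hL0]

end MertensSums

section IdealCounting

open Filter Topology Finset UniqueFactorizationMonoid Ideal
open scoped NumberField

variable (K : Type*) [Field K] [NumberField K]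

/-- The finite set of nonzero ideals of norm at most `n`. -/
noncomputable def idealsLE (n : ℕ) : Finset (Ideal (𝓞 K)) :=
  {I ∈ (finite_setOfPred_absNorm_le (S := 𝓞 K) n).toFinset | absNorm I ≠ 0}

/-- The number of nonzero ideals of norm `m`. -/
noncomputable def idealCount (m : ℕ) : ℕ := #{I ∈ idealsLE K m | absNorm I = m}

variable {K}

theorem mem_idealsLE {n : ℕ} {I : Ideal (𝓞 K)} :
    I ∈ idealsLE K n ↔ absNorm I ≤ n ∧ absNorm I ≠ 0 := by
  simp [idealsLE]

theorem sum_idealCount_mul (f : ℕ → ℝ) (n : ℕ) :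
    ∑ m ∈ Icc 1 n, (idealCount K m : ℝ) * f m = ∑ I ∈ idealsLE K n, f (absNorm I) := by
  rw [← sum_fiberwise_of_maps_to (s := idealsLE K n) (t := Icc 1 n) (g := fun I => absNorm I)]
  · refine sum_congr rfl fun m hm => ?_
    rw [mem_Icc] at hm
    have h : {I ∈ idealsLE K n | absNorm I = m} = {I ∈ idealsLE K m | absNorm I = m} := by
      ext I
      simp only [mem_filter, mem_idealsLE]
      constructor <;> rintro ⟨h1, h2⟩ <;> exact ⟨⟨by omega, h1.2⟩, h2⟩
    rw [h, idealCount, ← nsmul_eq_mul, ← sum_const]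
    refine sum_congr rfl fun I hI => ?_
    rw [(mem_filter.mp hI).2]
  · intro I hI
    rw [mem_idealsLE] at hI
    rw [mem_Icc]; omega

theorem sum_idealCount (n : ℕ) :
    ∑ m ∈ Icc 1 n, (idealCount K m : ℝ) = #(idealsLE K n) := by
  simpa using sum_idealCount_mul (K := K) (fun _ => 1) n

variable (K) in
theorem exists_tendsto_card_idealsLE_div :
    ∃ κ : ℝ, 0 < κ ∧ Tendsto (fun n : ℕ => (#(idealsLE K n) : ℝ) / n) atTop (𝓝 κ) := by
  refine ⟨_, NumberField.dedekindZeta_residue_pos K, ?_⟩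
  have h := (NumberField.Ideal.tendsto_norm_le_div_atTop₀ K).comp tendsto_natCast_atTop_atTop
  refine h.congr fun n => ?_
  simp only [Function.comp]
  congr 2
  rw [← Nat.card_eq_finsetCard]
  refine Nat.card_congr
    ⟨fun I => ⟨I.1.1, mem_idealsLE.mpr ⟨by exact_mod_cast I.2, ?_⟩⟩, fun I => ⟨⟨I.1, ?_⟩, ?_⟩,
      fun _ => rfl, fun _ => rfl⟩
  · exact absNorm_ne_zero_of_nonZeroDivisors I.1
  · exact absNorm_ne_zero_iff_mem_nonZeroDivisors.mp (mem_idealsLE.mp I.2).2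
  · exact_mod_cast (mem_idealsLE.mp I.2).1

theorem card_primes_mem_le {l : ℕ} (hl : l.Prime) (T : Finset (Ideal (𝓞 K)))
    (hT : ∀ P ∈ T, P.IsPrime ∧ (l : 𝓞 K) ∈ P) : #T ≤ Module.finrank ℤ (𝓞 K) := by
  have hl0 : (l : 𝓞 K) ≠ 0 := by exact_mod_cast hl.ne_zero
  have hne : ∀ P ∈ T, P ≠ ⊥ := fun P hP h => hl0 (by simpa [h] using (hT P hP).2)
  have hdvd : ∏ P ∈ T, P ∣ span {(l : 𝓞 K)} := by
    refine prod_primes_dvd _ (fun P hP => prime_of_isPrime (hne P hP) (hT P hP).1) fun P hP => ?_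
    rw [dvd_span_singleton]
    exact (hT P hP).2
  have h1 := absNorm_dvd_absNorm_of_le (le_of_dvd hdvd)
  rw [absNorm_span_natCast, map_prod] at h1
  have h2 : l ^ #T ∣ ∏ P ∈ T, absNorm P := by
    rw [← prod_const]
    refine prod_dvd_prod_of_dvd _ _ fun P hP => ?_
    have := (hT P hP).1
    obtain ⟨i, hi, h⟩ := (Nat.dvd_prime_pow hl).mp
      ((absNorm_dvd_absNorm_of_le ((span_singleton_le_iff_mem P).mpr (hT P hP).2)).trans
        (absNorm_span_natCast (S := 𝓞 K) l).dvd)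
    rw [h]
    refine dvd_pow_self _ fun h0 => this.ne_top ?_
    rw [← absNorm_eq_one_iff, h, h0, pow_zero]
  exact (Nat.pow_dvd_pow_iff_le_right hl.one_lt).mp (h2.trans h1)

theorem isPrime_of_absNorm_prime {P : Ideal (𝓞 K)} (h : (absNorm P).Prime) : P.IsPrime :=
  isPrime_of_irreducible_absNorm h

theorem idealCount_le_finrank {l : ℕ} (hl : l.Prime) :
    idealCount K l ≤ Module.finrank ℤ (𝓞 K) := by
  refine card_primes_mem_le hl _ fun P hP => ?_
  rw [mem_filter] at hP
  exact ⟨isPrime_of_absNorm_prime (hP.2 ▸ hl), hP.2 ▸ absNorm_mem P⟩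

open scoped Classical in
theorem filter_dvd_idealsLE {P : Ideal (𝓞 K)} (hP : absNorm P ≠ 0) (n : ℕ) :
    {I ∈ idealsLE K n | P ∣ I} = (idealsLE K (n / absNorm P)).image (P * ·) := by
  ext I
  simp only [mem_filter, mem_image, mem_idealsLE]
  constructor
  · rintro ⟨⟨h1, h2⟩, J, rfl⟩
    rw [map_mul] at h1 h2
    refine ⟨J, ⟨?_, right_ne_zero_of_mul h2⟩, rfl⟩
    rw [Nat.le_div_iff_mul_le (Nat.pos_of_ne_zero hP)]
    linarith
  · rintro ⟨J, ⟨h1, h2⟩, rfl⟩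
    rw [Nat.le_div_iff_mul_le (Nat.pos_of_ne_zero hP)] at h1
    rw [map_mul]
    exact ⟨⟨by linarith, mul_ne_zero hP h2⟩, dvd_mul_right _ _⟩

open scoped Classical in
theorem sum_filter_dvd_idealsLE {P : Ideal (𝓞 K)} (hP : absNorm P ≠ 0) (n : ℕ)
    (f : Ideal (𝓞 K) → ℝ) :
    ∑ I ∈ idealsLE K n with P ∣ I, f I = ∑ J ∈ idealsLE K (n / absNorm P), f (P * J) := by
  have hP0 : P ≠ 0 := fun h => hP (by rw [h]; simp)
  rw [filter_dvd_idealsLE hP, sum_image fun _ _ _ _ h => mul_left_cancel₀ hP0 h]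

open scoped Classical in
theorem sum_count_normalizedFactors {P : Ideal (𝓞 K)} (hP : absNorm P ≠ 0) (hPp : P.IsPrime)
    (n : ℕ) : ∑ I ∈ idealsLE K n, ((normalizedFactors I).count P : ℝ) =
      #(idealsLE K (n / absNorm P)) +
        ∑ I ∈ idealsLE K (n / absNorm P), ((normalizedFactors I).count P : ℝ) := by
  have hP0 : P ≠ 0 := fun h => hP (by rw [h]; simp)
  have hirr : Irreducible P := (prime_of_isPrime hP0 hPp).irreducible
  rw [← sum_filter_add_sum_filter_not _ (fun I => P ∣ I), sum_filter_dvd_idealsLE hP]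
  have h2 : ∑ I ∈ idealsLE K n with ¬P ∣ I, ((normalizedFactors I).count P : ℝ) = 0 := by
    refine sum_eq_zero fun I hI => ?_
    rw [Multiset.count_eq_zero_of_notMem fun h => (mem_filter.mp hI).2
      (dvd_of_mem_normalizedFactors h), Nat.cast_zero]
  rw [h2, add_zero, card_eq_sum_ones, Nat.cast_sum, ← sum_add_distrib]
  refine sum_congr rfl fun J hJ => ?_
  have hJ0 : J ≠ 0 := fun h => (mem_idealsLE.mp hJ).2 (by rw [h]; simp)
  rw [normalizedFactors_mul hP0 hJ0, normalizedFactors_irreducible hirr, normalize_eq,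
    Multiset.count_add, Multiset.count_singleton_self]
  push_cast; ring

open scoped Classical in
theorem sum_count_normalizedFactors_le {C : ℝ} (hC : ∀ n : ℕ, (#(idealsLE K n) : ℝ) ≤ C * n)
    {P : Ideal (𝓞 K)} (hP : absNorm P ≠ 0) (hPp : P.IsPrime) (n : ℕ) :
    ∑ I ∈ idealsLE K n, ((normalizedFactors I).count P : ℝ) ≤ 2 * C * n / absNorm P := by
  have hC0 : 0 ≤ C := by simpa using (Nat.cast_nonneg _).trans (hC 1)
  have hP2 : 2 ≤ absNorm P := by
    have : absNorm P ≠ 1 := fun h => hPp.ne_top (absNorm_eq_one_iff.mp h)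
    omega
  have hP2' : (2 : ℝ) ≤ absNorm P := by exact_mod_cast hP2
  induction n using Nat.strong_induction_on with
  | _ n ih =>
    rcases Nat.eq_zero_or_pos n with rfl | hn
    · rw [sum_eq_zero]
      · simp
      · intro I hI; rw [mem_idealsLE] at hI; omega
    · rw [sum_count_normalizedFactors hP hPp]
      have h1 := ih (n / absNorm P) (Nat.div_lt_self hn hP2)
      have h2 := hC (n / absNorm P)
      have h3 : ((n / absNorm P : ℕ) : ℝ) ≤ n / absNorm P := Nat.cast_div_le
      have h4 : 2 * C * (n / absNorm P : ℕ) / absNorm P ≤ C * (n / absNorm P : ℕ) := by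
        rw [div_le_iff₀ (by positivity)]
        nlinarith [mul_nonneg hC0 (Nat.cast_nonneg (α := ℝ) (n / absNorm P))]
      have h5 : C * ((n / absNorm P : ℕ) : ℝ) ≤ C * (n / absNorm P) := by gcongr
      calc _ ≤ 2 * (C * (n / absNorm P)) := by linarith
        _ = _ := by ring

open scoped Classical in
theorem log_absNorm_eq_sum {n : ℕ} {I : Ideal (𝓞 K)} (hI : I ∈ idealsLE K n) :
    Real.log (absNorm I) =
      ∑ P ∈ idealsLE K n with P.IsPrime, ((normalizedFactors I).count P : ℝ) *
        Real.log (absNorm P) := by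
  rw [mem_idealsLE] at hI
  have hI0 : I ≠ ⊥ := fun h => hI.2 (by rw [h]; simp)
  have h1 : Real.log (absNorm I) =
      ((normalizedFactors I).map fun P => Real.log (absNorm P)).sum := by
    conv_lhs => rw [← Ideal.prod_normalizedFactors_eq_self hI0]
    rw [map_multiset_prod, Nat.cast_multiset_prod, Real.log_multiset_prod, Multiset.map_map,
      Multiset.map_map]
    · rfl
    · simp only [Multiset.mem_map, forall_exists_index, and_imp, forall_apply_eq_imp_iff₂]
      intro P hP
      have hP0 := (prime_of_normalized_factor P hP).ne_zero
      rw [Nat.cast_ne_zero]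
      exact fun h => hP0 (absNorm_eq_zero_iff.mp h)
  rw [h1, sum_multiset_map_count]
  simp only [nsmul_eq_mul]
  refine sum_subset ?_ ?_
  · intro P hP
    rw [Multiset.mem_toFinset] at hP
    have hd := absNorm_dvd_absNorm_of_le (le_of_dvd (dvd_of_mem_normalizedFactors hP))
    rw [mem_filter, mem_idealsLE]
    exact ⟨⟨(Nat.le_of_dvd (Nat.pos_of_ne_zero hI.2) hd).trans hI.1,
      ne_zero_of_dvd_ne_zero hI.2 hd⟩,
      isPrime_of_prime (prime_of_normalized_factor P hP)⟩
  · intro P _ hP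
    rw [Multiset.mem_toFinset] at hP
    rw [Multiset.count_eq_zero_of_notMem hP]; simp

/-- The nonzero prime ideals of norm at most `n`. -/
noncomputable def primesNormLE (K : Type*) [Field K] [NumberField K] (n : ℕ) :
    Finset (Ideal (𝓞 K)) := by
  classical exact {P ∈ idealsLE K n | P.IsPrime}

theorem mem_primesNormLE {n : ℕ} {P : Ideal (𝓞 K)} :
    P ∈ primesNormLE K n ↔ (absNorm P ≤ n ∧ absNorm P ≠ 0) ∧ P.IsPrime := by
  simp [primesNormLE, mem_idealsLE]

theorem exists_prime_mem_absNorm_eq_pow {n : ℕ} {P : Ideal (𝓞 K)} (hP : P ∈ primesNormLE K n) :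
    (absNorm P).minFac.Prime ∧ ((absNorm P).minFac : 𝓞 K) ∈ P ∧
      ∃ i, i ≠ 0 ∧ absNorm P = (absNorm P).minFac ^ i := by
  rw [mem_primesNormLE] at hP
  have := hP.2
  have hP0 : P ≠ ⊥ := fun h => hP.1.2 (by rw [h]; simp)
  have := hP.2.isMaximal hP0
  obtain ⟨p, i, hi0, hpP, hp, hi⟩ := exists_prime_and_absNorm_eq_pow P
  rw [hi, hp.pow_minFac hi0.ne']
  exact ⟨hp, hpP, i, hi0.ne', rfl⟩

theorem sum_image_minFac_le {f g : ℕ → ℝ} (hg : ∀ l, 0 ≤ g l) (hgs : Summable g) {n : ℕ}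
    {T : Finset (Ideal (𝓞 K))} (hT : T ⊆ primesNormLE K n)
    (hfg : ∀ P ∈ T, f (absNorm P) ≤ g (absNorm P).minFac) :
    ∑ P ∈ T, f (absNorm P) ≤ Module.finrank ℤ (𝓞 K) * ∑' l, g l := by
  calc _ ≤ ∑ P ∈ T, g (absNorm P).minFac := sum_le_sum hfg
    _ = ∑ l ∈ T.image fun P => (absNorm P).minFac,
          #{P ∈ T | (absNorm P).minFac = l} * g l := by
        rw [sum_comp g]; simp
    _ ≤ ∑ l ∈ T.image fun P => (absNorm P).minFac, Module.finrank ℤ (𝓞 K) * g l := by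
        refine sum_le_sum fun l hl => ?_
        obtain ⟨P, hP, rfl⟩ := mem_image.mp hl
        have := hg (absNorm P).minFac
        gcongr
        refine card_primes_mem_le (exists_prime_mem_absNorm_eq_pow (hT hP)).1 _ fun Q hQ => ?_
        rw [mem_filter] at hQ
        exact ⟨(mem_primesNormLE.mp (hT hQ.1)).2,
          hQ.2 ▸ (exists_prime_mem_absNorm_eq_pow (hT hQ.1)).2.1⟩
    _ ≤ _ := by
        rw [← mul_sum]
        gcongr
        exact hgs.sum_le_tsum _ fun l _ => hg l

theorem sum_idealsLE_prime (f : ℕ → ℝ) (n : ℕ) :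
    ∑ I ∈ idealsLE K n with (absNorm I).Prime, f (absNorm I) =
      ∑ l ∈ n.primesLE, (idealCount K l : ℝ) * f l := by
  rw [sum_filter, ← sum_idealCount_mul (fun m => if m.Prime then f m else 0)]
  simp only [mul_ite, mul_zero]
  rw [← sum_filter]
  refine sum_congr ?_ fun _ _ => rfl
  ext l
  simp only [mem_filter, mem_Icc, Nat.mem_primesLE]
  exact ⟨fun h => ⟨h.1.2, h.2⟩, fun h => ⟨⟨h.2.one_le, h.1⟩, h.2⟩⟩

theorem log_div_le_of_prime_pow {q l i : ℕ} (hl : l.Prime) (hi : i ≠ 0) (hq : q = l ^ i) :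
    (if q.Prime then Real.log q / q ^ 2 else Real.log q / q) ≤ 4 * (1 / (l : ℝ) ^ (3 / 2 : ℝ)) := by
  have hl1 : (1 : ℝ) ≤ l := by exact_mod_cast hl.one_le
  have hq0 : (0 : ℝ) < q := by rw [hq]; push_cast; positivity
  have hlog : Real.log q ≤ 4 * (q : ℝ) ^ (1 / 4 : ℝ) := by
    refine (Real.log_le_rpow_div hq0.le (by norm_num : (0 : ℝ) < 1 / 4)).trans_eq ?_
    ring
  have hl0 : (0 : ℝ) < l := by linarith
  rw [one_div, ← Real.rpow_neg hl0.le]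
  have hqi : (q : ℝ) = (l : ℝ) ^ (i : ℝ) := by rw [hq]; push_cast; rw [Real.rpow_natCast]
  split_ifs with hqp
  · have hqi1 : (1 : ℝ) ≤ i := by exact_mod_cast Nat.one_le_iff_ne_zero.mpr hi
    calc _ ≤ 4 * (q : ℝ) ^ (1 / 4 : ℝ) / q ^ 2 := by gcongr
      _ = 4 * (l : ℝ) ^ (i * (-(7 / 4)) : ℝ) := by
        rw [Real.rpow_mul hl0.le, ← hqi, mul_div_assoc, ← Real.rpow_natCast, ← Real.rpow_sub hq0]
        norm_num
      _ ≤ _ := by gcongr; nlinarith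
  · have hi2 : (2 : ℝ) ≤ i := by
      have : i ≠ 1 := by rintro rfl; exact hqp (by rwa [hq, pow_one])
      exact_mod_cast (by omega : 2 ≤ i)
    calc _ ≤ 4 * (q : ℝ) ^ (1 / 4 : ℝ) / q := by gcongr
      _ = 4 * (l : ℝ) ^ (i * (-(3 / 4)) : ℝ) := by
        rw [Real.rpow_mul hl0.le, ← hqi, mul_div_assoc, ← Real.rpow_sub_one hq0.ne']
        norm_num
      _ ≤ _ := by gcongr; nlinarith

theorem sum_idealCount_mul_log_le (n : ℕ) :
    ∑ l ∈ n.primesLE, (idealCount K l : ℝ) * Real.log l *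
      ∑ m ∈ Icc 1 (n / l), (idealCount K m : ℝ) ≤
    ∑ m ∈ Icc 1 n, (idealCount K m : ℝ) * Real.log m := by
  classical
  rw [sum_idealCount_mul (fun m => Real.log m)]
  simp_rw [sum_idealCount, mul_assoc]
  rw [← sum_idealsLE_prime (fun l => Real.log l * (#(idealsLE K (n / l)) : ℝ))]
  calc _ = ∑ P ∈ idealsLE K n with (absNorm P).Prime, ∑ I ∈ idealsLE K n with P ∣ I,
        Real.log (absNorm P) := by
        refine sum_congr rfl fun P hP => ?_
        rw [sum_filter_dvd_idealsLE (mem_filter.mp hP).2.ne_zero]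
        simp [mul_comm]
    _ = ∑ I ∈ idealsLE K n, ∑ P ∈ idealsLE K n with (absNorm P).Prime,
          if P ∣ I then Real.log (absNorm P) else 0 := by
        simp_rw [sum_filter (p := fun I => _ ∣ I)]
        rw [sum_comm]
    _ ≤ _ := by
        refine sum_le_sum fun I hI => ?_
        rw [log_absNorm_eq_sum hI]
        have hI0 : I ≠ 0 := fun h => (mem_idealsLE.mp hI).2 (by rw [h]; simp)
        calc _ ≤ ∑ P ∈ idealsLE K n with (absNorm P).Prime,
              ((normalizedFactors I).count P : ℝ) * Real.log (absNorm P) := by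
              refine sum_le_sum fun P hP => ?_
              rw [mem_filter, mem_idealsLE] at hP
              have hlog := Real.log_natCast_nonneg (absNorm P)
              split_ifs with h
              · have hirr := irreducible_of_irreducible_absNorm hP.2
                obtain ⟨Q, hQ, hPQ⟩ := exists_mem_normalizedFactors_of_dvd hI0 hirr h
                rw [associated_iff_eq] at hPQ
                subst hPQ
                have : (1 : ℝ) ≤ (normalizedFactors I).count P := by
                  exact_mod_cast Multiset.one_le_count_iff_mem.mpr hQ
                nlinarith
              · positivity
          _ ≤ _ := by
              refine sum_le_sum_of_subset_of_nonneg ?_ fun P _ _ => ?_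
              · intro P hP
                rw [mem_filter] at hP ⊢
                exact ⟨hP.1, isPrime_of_absNorm_prime hP.2⟩
              · exact mul_nonneg (Nat.cast_nonneg _) (Real.log_natCast_nonneg _)

theorem exists_sum_mul_log_le_sum_idealCount (K : Type*) [Field K] [NumberField K] :
    ∃ E : ℝ, ∀ n : ℕ, ∑ m ∈ Icc 1 n, (idealCount K m : ℝ) * Real.log m ≤
      ∑ l ∈ n.primesLE, (idealCount K l : ℝ) * Real.log l *
        ∑ m ∈ Icc 1 (n / l), (idealCount K m : ℝ) + E * n := by
  classical
  obtain ⟨κ, hκ, hlim⟩ := exists_tendsto_card_idealsLE_div K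
  obtain ⟨C₀, hC₀, hC⟩ := exists_abs_sub_le_of_tendsto_div hlim one_pos
  have hC : ∀ n : ℕ, (#(idealsLE K n) : ℝ) ≤ (κ + 1 + C₀) * n := by
    intro n
    rcases Nat.eq_zero_or_pos n with rfl | hn
    · have : idealsLE K 0 = ∅ := by
        ext I; simp [mem_idealsLE]
      simp [this]
    · have := (abs_le.mp (hC n)).2
      have hn' : (1 : ℝ) ≤ n := by exact_mod_cast hn
      nlinarith
  set C := κ + 1 + C₀
  have hC0 : 0 ≤ C := by positivity
  set f : ℕ → ℝ := fun q => if q.Prime then Real.log q / q ^ 2 else Real.log q / q with hf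
  set g : ℕ → ℝ := fun l => 4 * (1 / (l : ℝ) ^ (3 / 2 : ℝ)) with hg
  have hgs : Summable g := (Real.summable_one_div_nat_rpow.mpr (by norm_num)).mul_left 4
  have hg0 : ∀ l, 0 ≤ g l := fun l => by positivity
  refine ⟨2 * C * (Module.finrank ℤ (𝓞 K) * ∑' l, g l), fun n => ?_⟩
  have hfsum := sum_image_minFac_le (f := f) hg0 hgs (subset_refl (primesNormLE K n)) fun P hP => by
    obtain ⟨h1, -, i, hi, h2⟩ := exists_prime_mem_absNorm_eq_pow hP
    exact log_div_le_of_prime_pow h1 hi h2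
  rw [sum_idealCount_mul (fun m => Real.log m)]
  simp_rw [sum_idealCount, mul_assoc]
  rw [← sum_idealsLE_prime (fun l => Real.log l * (#(idealsLE K (n / l)) : ℝ))]
  have hprimes : {P ∈ idealsLE K n | (absNorm P).Prime} =
      {P ∈ primesNormLE K n | (absNorm P).Prime} := by
    ext P
    simp only [mem_filter, mem_primesNormLE, mem_idealsLE]
    exact ⟨fun h => ⟨⟨h.1, isPrime_of_absNorm_prime h.2⟩, h.2⟩, fun h => ⟨h.1.1, h.2⟩⟩
  rw [hprimes, sum_filter]
  calc _ = ∑ P ∈ primesNormLE K n, Real.log (absNorm P) *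
        ∑ I ∈ idealsLE K n, ((normalizedFactors I).count P : ℝ) := by
        rw [sum_congr rfl fun I hI => log_absNorm_eq_sum hI, sum_comm]
        have : {P ∈ idealsLE K n | P.IsPrime} = primesNormLE K n := by
          ext P; simp [mem_primesNormLE, mem_idealsLE]
        rw [this]
        refine sum_congr rfl fun P _ => ?_
        rw [mul_sum]
        exact sum_congr rfl fun I _ => mul_comm _ _
    _ ≤ ∑ P ∈ primesNormLE K n, ((if (absNorm P).Prime then
          Real.log (absNorm P) * (#(idealsLE K (n / absNorm P)) : ℝ) else 0) +
            2 * C * n * f (absNorm P)) := by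
        refine sum_le_sum fun P hP => ?_
        rw [mem_primesNormLE] at hP
        have hlog := Real.log_natCast_nonneg (absNorm P)
        have hP0 : (0 : ℝ) < absNorm P := by exact_mod_cast Nat.pos_of_ne_zero hP.1.2
        simp only [hf]
        split_ifs with hp
        · rw [sum_count_normalizedFactors hP.1.2 hP.2, mul_add]
          refine add_le_add le_rfl ?_
          have h1 := sum_count_normalizedFactors_le hC hP.1.2 hP.2 (n / absNorm P)
          have h3 : ((n / absNorm P : ℕ) : ℝ) ≤ n / absNorm P := Nat.cast_div_le
          calc _ ≤ Real.log (absNorm P) * (2 * C * (n / absNorm P : ℕ) / absNorm P) := by gcongr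
            _ ≤ Real.log (absNorm P) * (2 * C * (n / absNorm P) / absNorm P) := by gcongr
            _ = _ := by field_simp
        · rw [zero_add]
          calc _ ≤ Real.log (absNorm P) * (2 * C * n / absNorm P) := by
                gcongr; exact sum_count_normalizedFactors_le hC hP.1.2 hP.2 n
            _ = _ := by ring
    _ ≤ _ := by
        rw [sum_add_distrib, ← mul_sum]
        have : 2 * C * n * ∑ P ∈ primesNormLE K n, f (absNorm P) ≤
          2 * C * n * (Module.finrank ℤ (𝓞 K) * ∑' l, g l) := by gcongr
        nlinarith

/-- Mertens' theorem for the prime ideals of degree one of a number field. -/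
theorem mertensSum_idealCount (K : Type*) [Field K] [NumberField K] {δ : ℝ} (hδ : 0 < δ) :
    ∀ᶠ n : ℕ in atTop, (1 - δ) * Real.log n ≤ mertensSum (fun l => idealCount K l) n ∧
      mertensSum (fun l => idealCount K l) n ≤ (1 + δ) * Real.log n := by
  obtain ⟨κ, hκ, hlim⟩ := exists_tendsto_card_idealsLE_div K
  obtain ⟨E, hE⟩ := exists_sum_mul_log_le_sum_idealCount K
  refine mertensSum_asymptotic (fun _ => Nat.cast_nonneg _)
    (fun l hl => Nat.cast_le.mpr (idealCount_le_finrank hl)) hκ (fun _ => Nat.cast_nonneg _) ?_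
    sum_idealCount_mul_log_le hE hδ
  simpa only [sum_idealCount] using hlim

end IdealCounting

section RootCounts

open Filter Topology Finset Polynomial Ideal
open scoped NumberField

/-- The roots modulo a prime `l` of a polynomial with integer coefficients. -/
noncomputable def rootsMod (Q : ℤ[X]) (l : ℕ) : Set (ZMod l) :=
  {x | eval₂ (Int.castRingHom (ZMod l)) x Q = 0}

variable {K : Type*} [Field K] [NumberField K]

theorem absNorm_ker {l : ℕ} [Fact l.Prime] (f : 𝓞 K →+* ZMod l) :
    absNorm (RingHom.ker f) = l := by
  rw [absNorm_apply, Submodule.cardQuot_apply,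
    Nat.card_congr (RingHom.quotientKerEquivOfSurjective (ZMod.ringHom_surjective f)).toEquiv,
    Nat.card_zmod]

theorem exists_ringHom_ker_eq {l : ℕ} [Fact l.Prime] {I : Ideal (𝓞 K)} (hI : absNorm I = l) :
    ∃ f : 𝓞 K →+* ZMod l, RingHom.ker f = I := by
  have hl : l.Prime := Fact.out
  have hc : Nat.card (𝓞 K ⧸ I) = l := by
    rw [← hI, absNorm_apply, Submodule.cardQuot_apply]
  have : Finite (𝓞 K ⧸ I) := Nat.finite_of_card_ne_zero (hc ▸ hl.ne_zero)
  let _ := Fintype.ofFinite (𝓞 K ⧸ I)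
  let e := ZMod.ringEquivOfPrime (𝓞 K ⧸ I) hl (by rw [← Nat.card_eq_fintype_card, hc])
  refine ⟨(e.symm : 𝓞 K ⧸ I →+* ZMod l).comp (Ideal.Quotient.mk I), ?_⟩
  ext x
  simp [RingHom.mem_ker, Ideal.Quotient.eq_zero_iff_mem]

theorem mem_idealsLE_filter {l : ℕ} (hl : l ≠ 0) {I : Ideal (𝓞 K)} :
    I ∈ ({I ∈ idealsLE K l | absNorm I = l} : Finset (Ideal (𝓞 K))) ↔ absNorm I = l := by
  rw [mem_filter, mem_idealsLE]
  exact ⟨fun h => h.2, fun h => ⟨by omega, h⟩⟩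

theorem finite_ringHom (K : Type*) [Field K] [NumberField K] {l : ℕ} (hl : l.Prime) :
    Finite (𝓞 K →+* ZMod l) :=
  have : Fact l.Prime := ⟨hl⟩
  Finite.of_injective (β := {I // I ∈ ({I ∈ idealsLE K l | absNorm I = l} : Finset (Ideal (𝓞 K)))})
    (fun f => ⟨RingHom.ker f, (mem_idealsLE_filter hl.ne_zero).mpr (absNorm_ker f)⟩)
    fun f g h => ZMod.ringHom_eq_of_ker_eq f g (Subtype.ext_iff.mp h)

/-- Ideals of prime norm `l` are counted by ring homomorphisms to `ZMod l`. -/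
theorem idealCount_eq_card_ringHom (K : Type*) [Field K] [NumberField K] {l : ℕ}
    (hl : l.Prime) : idealCount K l = Nat.card (𝓞 K →+* ZMod l) := by
  have : Fact l.Prime := ⟨hl⟩
  have e : (𝓞 K →+* ZMod l) ≃
      {I // I ∈ ({I ∈ idealsLE K l | absNorm I = l} : Finset (Ideal (𝓞 K)))} :=
    Equiv.ofBijective
      (fun f => ⟨RingHom.ker f, (mem_idealsLE_filter hl.ne_zero).mpr (absNorm_ker f)⟩)
      ⟨fun f g h => ZMod.ringHom_eq_of_ker_eq f g (Subtype.ext_iff.mp h), fun I => by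
        obtain ⟨f, hf⟩ := exists_ringHom_ker_eq ((mem_idealsLE_filter hl.ne_zero).mp I.2)
        exact ⟨f, Subtype.ext hf⟩⟩
  rw [Nat.card_congr e, Nat.card_eq_fintype_card, Fintype.card_coe, idealCount]

theorem exists_mul_mem_adjoin (s : Set (𝓞 K))
    (hs : Algebra.adjoin ℚ (algebraMap (𝓞 K) K '' s) = ⊤) :
    ∃ m : ℕ, m ≠ 0 ∧ ∀ x : 𝓞 K, (m : 𝓞 K) * x ∈ Algebra.adjoin ℤ s := by
  have key : ∀ x : 𝓞 K, ∃ m : ℕ, m ≠ 0 ∧ (m : 𝓞 K) * x ∈ Algebra.adjoin ℤ s := by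
    intro x
    obtain ⟨t, ht⟩ := multiple_mem_adjoin_of_mem_localization_adjoin (nonZeroDivisors ℤ) ℚ
      (algebraMap (𝓞 K) K '' s) (algebraMap (𝓞 K) K x) (by rw [hs]; trivial)
    have ht0 : (t : ℤ) ≠ 0 := nonZeroDivisors.coe_ne_zero t
    have h2 : (t : ℤ) • x ∈ Algebra.adjoin ℤ s := by
      have h3 : algebraMap (𝓞 K) K ((t : ℤ) • x) ∈
          (Algebra.adjoin ℤ s).map (IsScalarTower.toAlgHom ℤ (𝓞 K) K) := by
        rw [AlgHom.map_adjoin]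
        rw [map_zsmul]
        exact ht
      obtain ⟨y, hy, hyx⟩ := h3
      rwa [← FaithfulSMul.algebraMap_injective (𝓞 K) K hyx]
    refine ⟨(t : ℤ).natAbs, by simp, ?_⟩
    have h4 : ((t : ℤ).natAbs : 𝓞 K) * x = (t : ℤ).sign • ((t : ℤ) • x) := by
      rw [smul_smul, Int.sign_mul_self_eq_natAbs]; simp
    rw [h4]
    exact Subalgebra.smul_mem _ h2 _
  classical
  choose f hf hmem using key
  obtain ⟨S, hS⟩ := Module.Finite.fg_top (R := ℤ) (M := 𝓞 K)
  refine ⟨∏ x ∈ S, f x, prod_ne_zero_iff.mpr fun x _ => hf x, fun x => ?_⟩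
  have hx : x ∈ Submodule.span ℤ (S : Set (𝓞 K)) := by rw [hS]; trivial
  induction hx using Submodule.span_induction with
  | mem x hx =>
    rw [← mul_prod_erase S f hx, Nat.cast_mul, mul_comm (f x : 𝓞 K), mul_assoc]
    exact mul_mem (natCast_mem _ _) (hmem x)
  | zero => simp
  | add x y _ _ hx hy => rw [mul_add]; exact add_mem hx hy
  | smul a x _ hx => rw [mul_smul_comm]; exact Subalgebra.smul_mem _ hx a

omit [NumberField K] in
theorem eval₂_ringHom_eq_zero {l : ℕ} {Q : ℤ[X]} {θ : 𝓞 K} (hθ : aeval θ Q = 0)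
    (f : 𝓞 K →+* ZMod l) : f θ ∈ rootsMod Q l := by
  have h := congrArg f hθ
  rw [aeval_def, hom_eval₂, map_zero] at h
  rwa [rootsMod, Set.mem_ofPred_eq, RingHom.ext_int (Int.castRingHom (ZMod l)) (f.comp _)]

theorem natCast_zmod_ne_zero {l m : ℕ} (h : ¬ l ∣ m) : (m : ZMod l) ≠ 0 := by
  rwa [Ne, ZMod.natCast_eq_zero_iff]

theorem idealCount_add_ncard_rootsMod_le {Q : ℤ[X]} {θ₁ θ₂ : 𝓞 K} (hne : θ₁ ≠ θ₂)
    (h₁ : aeval θ₁ Q = 0) (h₂ : aeval θ₂ Q = 0)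
    (hs : Algebra.adjoin ℚ (algebraMap (𝓞 K) K '' {θ₁, θ₂}) = ⊤) :
    ∃ m : ℕ, m ≠ 0 ∧ ∀ l : ℕ, l.Prime → ¬ l ∣ m →
      idealCount K l + (rootsMod Q l).ncard ≤ (rootsMod Q l).ncard * (rootsMod Q l).ncard := by
  classical
  obtain ⟨m, hm0, hm⟩ := exists_mul_mem_adjoin _ hs
  set N := absNorm (Ideal.span {θ₁ - θ₂}) with hN
  have hN0 : N ≠ 0 := by
    rw [hN, Ne, absNorm_eq_zero_iff, Ideal.span_singleton_eq_bot, sub_eq_zero]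
    exact hne
  obtain ⟨y, hy⟩ := mem_span_singleton.mp (absNorm_mem (Ideal.span {θ₁ - θ₂}))
  refine ⟨m * N, mul_ne_zero hm0 hN0, fun l hl hlm => ?_⟩
  have : Fact l.Prime := ⟨hl⟩
  have hlm' : ¬ l ∣ m := fun h => hlm (h.mul_right _)
  have hlN : ¬ l ∣ N := fun h => hlm (h.mul_left _)
  set R := (rootsMod Q l).toFinset with hR
  have hRcard : (rootsMod Q l).ncard = #R := Set.ncard_eq_toFinset_card' _
  let Φ : (𝓞 K →+* ZMod l) → R.offDiag := fun f => ⟨(f θ₁, f θ₂), by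
    rw [mem_offDiag, hR, Set.mem_toFinset, Set.mem_toFinset]
    refine ⟨eval₂_ringHom_eq_zero h₁ f, eval₂_ringHom_eq_zero h₂ f, fun h => ?_⟩
    have := congrArg f hy
    rw [map_natCast, map_mul, map_sub, show f θ₁ = f θ₂ from h, sub_self, zero_mul] at this
    exact natCast_zmod_ne_zero hlN this⟩
  have hΦ : Function.Injective Φ := by
    intro f g hfg
    simp only [Φ, Subtype.mk.injEq, Prod.mk.injEq] at hfg
    ext x
    have h : Set.EqOn f.toIntAlgHom g.toIntAlgHom (Algebra.adjoin ℤ {θ₁, θ₂}) := by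
      rw [AlgHom.eqOn_adjoin_iff]
      rintro z (rfl | rfl)
      exacts [hfg.1, hfg.2]
    have h2 : f (m * x) = g (m * x) := h (hm x)
    rw [map_mul, map_mul, map_natCast, map_natCast] at h2
    exact mul_left_cancel₀ (natCast_zmod_ne_zero hlm') h2
  have h3 := Nat.card_le_card_of_injective Φ hΦ
  rw [← idealCount_eq_card_ringHom K hl, Nat.card_eq_fintype_card, Fintype.card_coe,
    offDiag_card] at h3
  rw [hRcard]
  have := Nat.le_mul_self #R
  omega

/-- A ring homomorphism on a subring `A` extends to an overring `O` when a multiple of `O`, by a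
natural number that remains invertible, lies in `A`. -/
theorem exists_ringHom_extension {O F : Type*} [CommRing O] [Field F] (A : Subalgebra ℤ O)
    (f : A →+* F) {m : ℕ} (hm : (m : F) ≠ 0) (hA : ∀ x : O, (m : O) * x ∈ A) :
    ∃ g : O →+* F, ∀ x : A, g x = f x := by
  refine ⟨{ toFun := fun x => f ⟨_, hA x⟩ / m
            map_one' := ?_
            map_mul' := fun x y => ?_
            map_zero' := ?_
            map_add' := fun x y => ?_ }, fun x => ?_⟩
  · rw [div_eq_one_iff_eq hm, ← map_natCast f]
    congr 1; ext; simp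
  · rw [div_mul_div_comm, ← map_mul, div_eq_div_iff hm (mul_ne_zero hm hm), ← mul_assoc,
      mul_right_comm, mul_left_inj' hm, ← map_natCast f, ← map_mul]
    congr 1; ext; push_cast; ring
  · rw [div_eq_zero_iff]; left
    rw [← map_zero f]; congr 1; ext; simp
  · rw [← add_div, ← map_add]; congr 2; ext; push_cast; ring
  · simp only [RingHom.coe_mk, MonoidHom.coe_mk, OneHom.coe_mk]
    rw [div_eq_iff hm, ← map_natCast f, ← map_mul]
    congr 1; ext; push_cast; ring

theorem ncard_rootsMod_le_idealCount {Q : ℤ[X]} {θ : 𝓞 K} (hQ : minpoly ℤ θ = Q)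
    (hs : Algebra.adjoin ℚ (algebraMap (𝓞 K) K '' {θ}) = ⊤) :
    ∃ m : ℕ, m ≠ 0 ∧ ∀ l : ℕ, l.Prime → ¬ l ∣ m →
      (rootsMod Q l).ncard ≤ idealCount K l := by
  obtain ⟨m, hm0, hm⟩ := exists_mul_mem_adjoin _ hs
  refine ⟨m, hm0, fun l hl hlm => ?_⟩
  have : Fact l.Prime := ⟨hl⟩
  have hθ : IsIntegral ℤ θ := Algebra.IsIntegral.isIntegral θ
  have key : ∀ x : rootsMod Q l, ∃ g : 𝓞 K →+* ZMod l, g θ = x := by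
    rintro ⟨x, hx⟩
    have hx' : eval₂ (Int.castRingHom (ZMod l)) x (minpoly ℤ θ) = 0 := hQ ▸ hx
    let f : Algebra.adjoin ℤ {θ} →+* ZMod l :=
      (AdjoinRoot.lift (Int.castRingHom (ZMod l)) x hx').comp
        (minpoly.equivAdjoin hθ).symm.toRingEquiv.toRingHom
    obtain ⟨g, hg⟩ := exists_ringHom_extension _ f (natCast_zmod_ne_zero hlm) hm
    refine ⟨g, (hg ⟨θ, Algebra.self_mem_adjoin_singleton ℤ θ⟩).trans ?_⟩
    have : (minpoly.equivAdjoin hθ).symm ⟨θ, Algebra.self_mem_adjoin_singleton ℤ θ⟩ =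
        AdjoinRoot.root _ := by
      rw [AlgEquiv.symm_apply_eq]
      simp
    change AdjoinRoot.lift _ x hx' ((minpoly.equivAdjoin hθ).symm _) = x
    rw [this, AdjoinRoot.lift_root]
  choose g hg using key
  rw [idealCount_eq_card_ringHom K hl, ← Nat.card_coe_set_eq]
  have := finite_ringHom K hl
  exact Nat.card_le_card_of_injective g fun x y h => Subtype.ext (by rw [← hg x, ← hg y, h])

theorem ncard_rootsMod_le {Q : ℤ[X]} (hQ : Q.Monic) {l : ℕ} (hl : l.Prime) :
    (rootsMod Q l).ncard ≤ Q.natDegree := by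
  classical
  have : Fact l.Prime := ⟨hl⟩
  have h : rootsMod Q l = ((Q.map (Int.castRingHom (ZMod l))).roots.toFinset : Set (ZMod l)) := by
    ext x
    simp [rootsMod, (hQ.map _).ne_zero, eval_map]
  rw [h, Set.ncard_coe_finset]
  exact (Multiset.toFinset_card_le _).trans ((card_roots' _).trans natDegree_map_le)

theorem exists_numberField_adjoin {ι : Type*} [Finite ι] (x : ι → AlgebraicClosure ℚ)
    (hx : ∀ i, IsIntegral ℤ (x i)) :
    ∃ K : IntermediateField ℚ (AlgebraicClosure ℚ), ∃ _ : NumberField K, ∃ θ : ι → 𝓞 K,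
      (∀ i, ((θ i : K) : AlgebraicClosure ℚ) = x i) ∧
      Algebra.adjoin ℚ (algebraMap (𝓞 K) K '' Set.range θ) = ⊤ := by
  let K := IntermediateField.adjoin ℚ (Set.range x)
  have hxQ : ∀ i, IsIntegral ℚ (x i) := fun i => (hx i).tower_top
  have hK : FiniteDimensional ℚ K :=
    IntermediateField.finiteDimensional_adjoin (by rintro _ ⟨i, rfl⟩; exact hxQ i)
  let y : ι → K := fun i => ⟨x i, IntermediateField.subset_adjoin _ _ ⟨i, rfl⟩⟩
  have hy : ∀ i, IsIntegral ℤ (y i) := fun i =>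
    (isIntegral_algebraMap_iff (algebraMap K (AlgebraicClosure ℚ)).injective).mp (hx i)
  refine ⟨K, { to_charZero := inferInstance, to_finiteDimensional := hK },
    fun i => ⟨y i, hy i⟩, fun i => rfl, ?_⟩
  have himage : algebraMap (𝓞 K) K '' Set.range (fun i => (⟨y i, hy i⟩ : 𝓞 K)) = Set.range y :=
    (Set.range_comp _ _).symm
  have htop : @Algebra.adjoin ℚ K _ _ K.algebra' (Set.range y) = ⊤ := by
    refine Subalgebra.map_injective (f := K.val) K.val.injective ?_
    have hval : K.val.range = K.toSubalgebra := K.range_val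
    rw [AlgHom.map_adjoin, Algebra.map_top, ← Set.range_comp, hval,
      IntermediateField.adjoin_toSubalgebra_of_isAlgebraic]
    · rfl
    · rintro _ ⟨i, rfl⟩; exact (hxQ i).isAlgebraic
  rw [himage]
  have htransfer : ∀ i₁ i₂ : Algebra ℚ K, @Algebra.adjoin ℚ K _ _ i₁ (Set.range y) = ⊤ →
      @Algebra.adjoin ℚ K _ _ i₂ (Set.range y) = ⊤ := fun i₁ i₂ h => by
    obtain rfl : i₁ = i₂ := Subsingleton.elim _ _
    exact h
  exact htransfer _ _ htop

theorem minpoly_eq_of_monic_irreducible {O : Type*} [CommRing O] [IsDomain O] [CharZero O]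
    {Q : ℤ[X]} (hQ : Q.Monic) (hirr : Irreducible Q) {θ : O} (h : aeval θ Q = 0) :
    minpoly ℤ θ = Q := by
  have hθ : IsIntegral ℤ θ := ⟨Q, hQ, h⟩
  have hd := minpoly.isIntegrallyClosed_dvd hθ h
  refine eq_of_monic_of_associated (minpoly.monic hθ) hQ ?_
  exact (hirr.dvd_iff.mp hd).resolve_left (minpoly.not_isUnit ℤ θ) |>.symm

theorem exists_two_roots {Q : ℤ[X]} (hQ : Q.Monic) (hirr : Irreducible Q)
    (hd : 2 ≤ Q.natDegree) :
    ∃ x : Fin 2 → AlgebraicClosure ℚ, x 0 ≠ x 1 ∧ ∀ i, aeval (x i) Q = 0 := by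
  have hirr' : Irreducible (Q.map (algebraMap ℤ ℚ)) :=
    (hQ.irreducible_iff_irreducible_map_fraction_map).mp hirr
  have hc := card_rootSet_eq_natDegree (K := AlgebraicClosure ℚ) hirr'.separable
    (IsAlgClosed.splits _)
  rw [natDegree_map_eq_of_injective (algebraMap ℤ ℚ).injective_int] at hc
  have : 1 < Fintype.card ((Q.map (algebraMap ℤ ℚ)).rootSet (AlgebraicClosure ℚ)) := by omega
  obtain ⟨a, b, hab⟩ := Fintype.one_lt_card_iff.mp this
  have hroot : ∀ a : (Q.map (algebraMap ℤ ℚ)).rootSet (AlgebraicClosure ℚ),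
      aeval (a : AlgebraicClosure ℚ) Q = 0 := fun a => by
    have := (mem_rootSet.mp a.2).2
    rwa [aeval_map_algebraMap] at this
  refine ⟨![a, b], by simpa [Subtype.ext_iff] using hab, fun i => ?_⟩
  fin_cases i
  exacts [hroot a, hroot b]

/-- The contribution of finitely many primes to a Mertens sum is bounded. -/
theorem mertensSum_le_add_const {a b : ℕ → ℝ} {m : ℕ} {B : ℝ} (hB : 0 ≤ B)
    (h : ∀ l, l.Prime → m < l → a l ≤ b l) (h' : ∀ l, l.Prime → a l ≤ b l + B) (n : ℕ) :
    mertensSum a n ≤ mertensSum b n + B * ∑ l ∈ range (m + 1), Real.log l / l := by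
  have h0 : ∀ l : ℕ, 0 ≤ Real.log l / l := fun l =>
    div_nonneg (Real.log_natCast_nonneg l) l.cast_nonneg
  have h1 : ∑ l ∈ n.primesLE, (if l ≤ m then B * (Real.log l / l) else 0) ≤
      B * ∑ l ∈ range (m + 1), Real.log l / l := by
    rw [← sum_filter, mul_sum]
    refine sum_le_sum_of_subset_of_nonneg (fun l hl => ?_) fun l _ _ => mul_nonneg hB (h0 l)
    rw [mem_filter] at hl
    rw [Finset.mem_range]; omega
  refine le_trans ?_ (add_le_add le_rfl h1)
  rw [mertensSum, mertensSum, ← sum_add_distrib]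
  refine sum_le_sum fun l hl => ?_
  have hp := Nat.prime_of_mem_primesLE hl
  rw [mul_div_assoc, mul_div_assoc]
  split_ifs with hlm
  · rw [← add_mul]; exact mul_le_mul_of_nonneg_right (h' l hp) (h0 l)
  · rw [add_zero]; exact mul_le_mul_of_nonneg_right (h l hp (by omega)) (h0 l)

/-- The proportion of primes modulo which a monic irreducible polynomial of degree `d ≥ 2` has no
root is at least `1 / d`. -/
theorem eventually_le_mertensSum_rootsMod {Q : ℤ[X]} (hQ : Q.Monic) (hirr : Irreducible Q)
    (hd : 2 ≤ Q.natDegree) {ε : ℝ} (hε : 0 < ε) :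
    ∀ᶠ n : ℕ in atTop, (1 - ε) * Real.log n ≤
      Q.natDegree * mertensSum (fun l => if (rootsMod Q l).ncard = 0 then 1 else 0) n := by
  obtain ⟨x, hx01, hx⟩ := exists_two_roots hQ hirr hd
  have hxint : ∀ i, IsIntegral ℤ (x i) := fun i => ⟨Q, hQ, hx i⟩
  obtain ⟨K₁, _, θ, hθ, hθtop⟩ := exists_numberField_adjoin (fun _ : Unit => x 0) fun _ => hxint 0
  obtain ⟨K₂, _, η, hη, hηtop⟩ := exists_numberField_adjoin x hxint
  have hroot : ∀ (K : IntermediateField ℚ (AlgebraicClosure ℚ)) (ξ : 𝓞 K) (i : Fin 2),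
      ((ξ : K) : AlgebraicClosure ℚ) = x i → aeval ξ Q = 0 := fun K ξ i h => by
    refine FaithfulSMul.algebraMap_injective (𝓞 K) (AlgebraicClosure ℚ) ?_
    rw [← aeval_algebraMap_apply, map_zero]
    exact (congrArg (aeval · Q) h).trans (hx i)
  obtain ⟨m₁, hm₁, h₁⟩ := ncard_rootsMod_le_idealCount (θ := θ ())
    (minpoly_eq_of_monic_irreducible hQ hirr (hroot K₁ _ 0 (hθ ())))
    (by rw [← hθtop, Set.range_unique])
  obtain ⟨m₂, hm₂, h₂⟩ := idealCount_add_ncard_rootsMod_le (θ₁ := η 0) (θ₂ := η 1)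
    (fun h => hx01 (by rw [← hη, ← hη, h])) (hroot K₂ _ 0 (hη 0)) (hroot K₂ _ 1 (hη 1))
    (by rw [← hηtop]; congr 2; ext; simp [eq_comm])
  set d := Q.natDegree
  set B : ℝ := Module.finrank ℤ (𝓞 K₂) + d
  set e : ℕ → ℝ := fun l => if (rootsMod Q l).ncard = 0 then 1 else 0 with he
  have he0 : ∀ l, 0 ≤ e l := fun l => by simp only [he]; split_ifs <;> norm_num
  have hQ1 : ∀ l : ℕ, l.Prime → idealCount ℚ l ≤ 1 := fun l hl => by
    have := idealCount_le_finrank (K := ℚ) hl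
    rwa [NumberField.RingOfIntegers.rank, Module.finrank_self] at this
  have hsum := fun n => mertensSum_le_add_const (m := m₁ * m₂) (B := B) (n := n)
    (a := fun l => idealCount K₂ l + d * idealCount ℚ l)
    (b := fun l => d * e l + d * idealCount K₁ l) (by positivity)
    (fun l hl hlm => by
      have hlm' : ¬ l ∣ m₁ * m₂ := fun h =>
        (Nat.le_of_dvd (Nat.pos_of_ne_zero (mul_ne_zero hm₁ hm₂)) h).not_gt hlm
      have h1 := h₁ l hl fun h => hlm' (h.mul_right _)
      have h2 := h₂ l hl fun h => hlm' (h.mul_left _)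
      have h3 := ncard_rootsMod_le hQ hl
      have h4 := hQ1 l hl
      simp only [he]
      set π := (rootsMod Q l).ncard
      split_ifs with hπ
      · rw [hπ] at h2
        have h5 : idealCount K₂ l = 0 := by omega
        rw [h5]
        have : (idealCount ℚ l : ℝ) ≤ 1 := by exact_mod_cast h4
        have h6 : (d : ℝ) * idealCount ℚ l ≤ d * 1 := by gcongr
        have h7 : (0 : ℝ) ≤ d * idealCount K₁ l := by positivity
        push_cast; linarith
      · rify at h1 h2 h3 h4
        have hπ1 : (1 : ℝ) ≤ π := by exact_mod_cast Nat.one_le_iff_ne_zero.mpr hπ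
        have hd0 : (0 : ℝ) ≤ d := by positivity
        have h5 : (d : ℝ) * idealCount ℚ l ≤ d * 1 := by gcongr
        have h6 : (d : ℝ) * π ≤ d * idealCount K₁ l := by gcongr
        nlinarith [mul_nonneg (sub_nonneg.mpr hπ1) (sub_nonneg.mpr h3)])
    (fun l hl => by
      have h1 : (idealCount K₂ l : ℝ) ≤ Module.finrank ℤ (𝓞 K₂) := by
        exact_mod_cast idealCount_le_finrank hl
      have h2 : (idealCount ℚ l : ℝ) ≤ 1 := by exact_mod_cast hQ1 l hl
      have h3 : (d : ℝ) * idealCount ℚ l ≤ d * 1 := by gcongr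
      have h4 : (0 : ℝ) ≤ d * e l + d * idealCount K₁ l := by
        have := he0 l; positivity
      simp only [B]; linarith)
  set C := B * ∑ l ∈ range (m₁ * m₂ + 1), Real.log l / l
  have hlin : ∀ (u v : ℕ → ℝ) (c : ℝ) (n : ℕ),
      mertensSum (fun l => u l + c * v l) n = mertensSum u n + c * mertensSum v n := by
    intro u v c n
    simp only [mertensSum, mul_sum, ← sum_add_distrib]
    exact sum_congr rfl fun l _ => by ring
  have hlin' : ∀ (u : ℕ → ℝ) (c : ℝ) (n : ℕ),
      mertensSum (fun l => c * u l) n = c * mertensSum u n := by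
    intro u c n
    simp only [mertensSum, mul_sum]
    exact sum_congr rfl fun l _ => by ring
  simp only [hlin, hlin'] at hsum
  set δ := ε / (2 * (1 + 2 * d)) with hδ
  have hδ0 : 0 < δ := by positivity
  have hδε : δ * (1 + 2 * d) = ε / 2 := by rw [hδ]; field_simp
  have hlog : ∀ᶠ n : ℕ in atTop, 2 * C / ε ≤ Real.log n :=
    (Real.tendsto_log_atTop.comp tendsto_natCast_atTop_atTop).eventually_ge_atTop _
  filter_upwards [mertensSum_idealCount K₁ hδ0, mertensSum_idealCount K₂ hδ0,
    mertensSum_idealCount ℚ hδ0, hlog] with n ⟨_, hK₁⟩ ⟨hK₂, _⟩ ⟨hQn, _⟩ hn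
  rw [div_le_iff₀ hε] at hn
  have h1 := hsum n
  have h2 : (d : ℝ) * ((1 - δ) * Real.log n) ≤ d * mertensSum (fun l => idealCount ℚ l) n := by
    gcongr
  have h3 : (d : ℝ) * mertensSum (fun l => idealCount K₁ l) n ≤ d * ((1 + δ) * Real.log n) := by
    gcongr
  have h4 : δ * (1 + 2 * d) * Real.log n = ε / 2 * Real.log n := by rw [hδε]
  linarith

end RootCounts

section Factorials

open Filter Topology Finset Polynomial

theorem pow_dvd_factorial_mul {l : ℕ} (hl : 0 < l) (k : ℕ) : l ^ k ∣ (l * k).factorial := by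
  induction k with
  | zero => simp
  | succ k ih =>
    rw [pow_succ, Nat.mul_succ]
    exact (mul_dvd_mul ih (Nat.dvd_factorial hl le_rfl)).trans
      (Nat.factorial_mul_factorial_dvd_factorial_add _ _)

theorem pow_div_dvd_factorial {l : ℕ} (hl : 0 < l) (n : ℕ) : l ^ (n / l) ∣ n.factorial :=
  (pow_dvd_factorial_mul hl _).trans (Nat.factorial_dvd_factorial (Nat.mul_div_le n l))

theorem not_dvd_eval_of_rootsMod {Q : ℤ[X]} {l : ℕ} (h : rootsMod Q l = ∅) (b : ℤ) :
    ¬ (l : ℤ) ∣ Q.eval b := by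
  intro hd
  have : (b : ZMod l) ∈ rootsMod Q l := by
    have h1 := (ZMod.intCast_zmod_eq_zero_iff_dvd _ _).mpr hd
    rw [rootsMod, Set.mem_ofPred_eq]
    rw [← eq_intCast (Int.castRingHom (ZMod l)), ← eval₂_id, hom_eval₂] at h1
    simpa using h1
  simp [h] at this

theorem mertensSum_le_log_of_factorial_eq {Q : ℤ[X]} {n : ℕ} {b u : ℤ}
    (h : (n.factorial : ℤ) = u * Q.eval b) :
    n * mertensSum (fun l => if (rootsMod Q l).ncard = 0 then 1 else 0) n - 2 * n ≤
      Real.log |(u : ℝ)| := by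
  classical
  have hu : u ≠ 0 := by
    rintro rfl
    rw [zero_mul] at h
    exact n.factorial_ne_zero (by exact_mod_cast h)
  set S : Finset ℕ := {l ∈ n.primesLE | (rootsMod Q l).ncard = 0} with hS
  have hSp : ∀ l ∈ S, l.Prime := fun l hl => Nat.prime_of_mem_primesLE (mem_filter.mp hl).1
  have hdvd : ∏ l ∈ S, l ^ (n / l) ∣ u.natAbs := by
    refine Finset.prod_dvd_of_isRelPrime (fun l hl k hk hlk => ?_) fun l hl => ?_
    · exact Nat.coprime_iff_isRelPrime.mp
        (Nat.Coprime.pow _ _ ((Nat.coprime_primes (hSp l hl) (hSp k hk)).mpr hlk))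
    · have : Fact l.Prime := ⟨hSp l hl⟩
      have h0 : rootsMod Q l = ∅ := (Set.ncard_eq_zero (Set.toFinite _)).mp (mem_filter.mp hl).2
      have h1 : l ^ (n / l) ∣ u.natAbs * (Q.eval b).natAbs := by
        rw [← Int.natAbs_mul, ← h, Int.natAbs_natCast]
        exact pow_div_dvd_factorial (hSp l hl).pos n
      refine Nat.Coprime.dvd_of_dvd_mul_right (Nat.Coprime.pow_left _ ?_) h1
      rw [Nat.Prime.coprime_iff_not_dvd (hSp l hl), ← Int.natCast_dvd]
      exact not_dvd_eval_of_rootsMod h0 b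
  have hle : ((∏ l ∈ S, l ^ (n / l) : ℕ) : ℝ) ≤ |(u : ℝ)| := by
    rw [← Int.cast_abs, ← Nat.cast_natAbs]
    exact_mod_cast Nat.le_of_dvd (Int.natAbs_pos.mpr hu) hdvd
  have hlog := Real.log_le_log (by
    exact_mod_cast prod_pos fun l hl => pow_pos (hSp l hl).pos _) hle
  refine le_trans ?_ hlog
  push_cast
  rw [Real.log_prod (fun l hl => pow_ne_zero _ (by exact_mod_cast (hSp l hl).ne_zero))]
  have h1 : ∑ l ∈ S, Real.log l ≤ 2 * n :=
    (sum_le_sum_of_subset_of_nonneg (filter_subset _ _)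
      fun l _ _ => Real.log_natCast_nonneg l).trans (sum_log_primesLE_le n)
  have h2 : (n : ℝ) * mertensSum (fun l => if (rootsMod Q l).ncard = 0 then 1 else 0) n =
      ∑ l ∈ S, (n : ℝ) / l * Real.log l := by
    rw [mertensSum, mul_sum, hS, sum_filter]
    refine sum_congr rfl fun l _ => ?_
    split_ifs <;> ring
  have h3 : ∑ l ∈ S, (n : ℝ) / l * Real.log l ≤
      ∑ l ∈ S, (Real.log ((l : ℝ) ^ (n / l)) + Real.log l) := by
    refine sum_le_sum fun l hl => ?_
    rw [Real.log_pow, ← add_one_mul]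
    have := Real.log_natCast_nonneg l
    gcongr
    rw [div_le_iff₀ (by exact_mod_cast (hSp l hl).pos)]
    have h1 := Nat.div_add_mod n l
    have h2 := Nat.mod_lt n (hSp l hl).pos
    exact_mod_cast (by nlinarith : n ≤ (n / l + 1) * l)
  rw [sum_add_distrib] at h3
  linarith

theorem log_factorial_le (n : ℕ) : Real.log n.factorial ≤ n * Real.log n := by
  rw [← Real.log_pow]
  refine Real.log_le_log (by exact_mod_cast n.factorial_pos) ?_
  exact_mod_cast Nat.factorial_le_pow n

/-- A repunit of length `d + 2` in base `b`, shifted so that it is divisible by `b - r` with an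
irreducible cofactor, is not a large factorial. -/
theorem eventually_factorial_ne {Q : ℤ[X]} (hQ : Q.Monic) (hirr : Irreducible Q)
    (hd : 2 ≤ Q.natDegree) (r c : ℤ)
    (h : ∀ b : ℤ, ∑ i ∈ range (Q.natDegree + 2), b ^ i - c = (b - r) * Q.eval b) :
    ∀ᶠ n : ℕ in atTop, ∀ b : ℤ, 2 ≤ b →
      (n.factorial : ℤ) ≠ ∑ i ∈ range (Q.natDegree + 2), b ^ i - c := by
  set d := Q.natDegree
  have hd0 : (0 : ℝ) < d := by exact_mod_cast (by omega : 0 < d)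
  set C : ℝ := (d + 1) * Real.log (1 + |(r : ℝ)|) + Real.log (1 + |(c : ℝ)|) with hC
  have hC0 : 0 ≤ C := by
    have h1 : 0 ≤ Real.log (1 + |(r : ℝ)|) := Real.log_nonneg (by linarith [abs_nonneg (r : ℝ)])
    have h2 : 0 ≤ Real.log (1 + |(c : ℝ)|) := Real.log_nonneg (by linarith [abs_nonneg (c : ℝ)])
    positivity
  have hε : (0 : ℝ) < 1 / (2 * (d + 1)) := by positivity
  have hlog : ∀ᶠ n : ℕ in atTop, 2 * (2 * d * (d + 1) + d * C) < Real.log n :=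
    (Real.tendsto_log_atTop.comp tendsto_natCast_atTop_atTop).eventually_gt_atTop _
  filter_upwards [eventually_le_mertensSum_rootsMod hQ hirr hd hε, hlog, eventually_ge_atTop 1]
    with n hn hn' hn1 b hb heq
  have heq' := heq.trans (h b)
  have hlow := mertensSum_le_log_of_factorial_eq heq'
  have hn1' : (1 : ℝ) ≤ n := by exact_mod_cast hn1
  have hf1 : (1 : ℝ) ≤ n.factorial := by exact_mod_cast n.factorial_pos
  have hbr : b - r ≠ 0 := by
    rintro h0
    rw [h0, zero_mul] at heq'
    exact n.factorial_ne_zero (by exact_mod_cast heq')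
  have hb2 : (2 : ℝ) ≤ b := by exact_mod_cast hb
  have hb0 : (0 : ℝ) < b := by linarith
  have hpow : (b : ℝ) ^ (d + 1) ≤ n.factorial * (1 + |(c : ℝ)|) := by
    have h1 : b ^ (d + 1) ≤ ∑ i ∈ range (d + 2), b ^ i :=
      single_le_sum (f := fun i => b ^ i) (fun i _ => by positivity) (by simp)
    have h2 : (b : ℝ) ^ (d + 1) ≤ n.factorial + c := by
      have : b ^ (d + 1) ≤ n.factorial + c := by linarith
      exact_mod_cast this
    nlinarith [le_abs_self (c : ℝ), abs_nonneg (c : ℝ)]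
  have habs : |((b - r : ℤ) : ℝ)| ≤ (1 + |(r : ℝ)|) * b := by
    push_cast
    refine (abs_sub _ _).trans ?_
    rw [abs_of_pos hb0]
    nlinarith [abs_nonneg (r : ℝ)]
  have habs0 : 0 < |((b - r : ℤ) : ℝ)| := abs_pos.mpr (by exact_mod_cast hbr)
  have hup : (d + 1) * Real.log |((b - r : ℤ) : ℝ)| ≤ n * Real.log n + C := by
    have h1 := Real.log_le_log habs0 habs
    rw [Real.log_mul (by positivity) hb0.ne'] at h1
    have h2 := Real.log_le_log (by positivity) hpow
    rw [Real.log_mul (by positivity) (by positivity), Real.log_pow] at h2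
    push_cast at h2
    have h3 := log_factorial_le n
    have h4 : ((d : ℝ) + 1) * Real.log |((b - r : ℤ) : ℝ)| ≤
      (d + 1) * (Real.log (1 + |(r : ℝ)|) + Real.log b) := by gcongr
    rw [hC]; linarith
  set W := mertensSum (fun l => if (rootsMod Q l).ncard = 0 then 1 else 0) n
  set L := Real.log n
  have h1 : (d + 1) * ((1 - 1 / (2 * (d + 1))) * L) * n ≤ (d + 1) * (d * W) * n := by gcongr
  have h2 : (d + 1) * ((1 - 1 / (2 * (d + 1))) * L) * n = (d + 1 / 2) * L * n := by
    field_simp; ring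
  have h3 : d * ((d + 1) * (n * W - 2 * n)) ≤ d * (n * L + C) := by
    refine mul_le_mul_of_nonneg_left (le_trans ?_ hup) hd0.le
    exact mul_le_mul_of_nonneg_left hlow (by positivity)
  have h4 : d * C ≤ d * C * n := le_mul_of_one_le_right (by positivity) hn1'
  nlinarith

end Factorials

section Irreducibility

open Filter Topology Finset Polynomial

theorem le_norm_prod_sub {t : ℝ} (ht : 1 ≤ t) (x : ℂ) (M : Multiset ℂ)
    (h : ∀ z ∈ M, t ≤ ‖x - z‖) : t ^ M.card ≤ ‖(M.map (x - ·)).prod‖ := by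
  induction M using Multiset.induction_on with
  | empty => simp
  | cons z M ih =>
    rw [Multiset.map_cons, Multiset.prod_cons, norm_mul, Multiset.card_cons, pow_succ']
    exact mul_le_mul (h z (by simp)) (ih fun w hw => h w (by simp [hw])) (by positivity)
      (norm_nonneg _)

theorem le_abs_eval_of_roots {f : ℤ[X]} (hf : f.Monic) (hd : f.natDegree ≠ 0) {t : ℝ}
    (ht : 1 ≤ t) {m : ℤ} (h : ∀ z : ℂ, aeval z f = 0 → t ≤ ‖(m : ℂ) - z‖) :
    t ≤ |((f.eval m : ℤ) : ℝ)| := by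
  set g := f.map (algebraMap ℤ ℂ)
  have hg : g.Monic := hf.map _
  have hs : g.Splits := IsAlgClosed.splits g
  have h1 := le_norm_prod_sub ht (m : ℂ) g.roots fun z hz => h z (by
    rw [aeval_def, ← eval_map]
    exact (mem_roots'.mp hz).2)
  rw [← hs.eval_eq_prod_roots_of_monic hg, ← hs.natDegree_eq_card_roots, hf.natDegree_map] at h1
  have h2 : g.eval (m : ℂ) = ((f.eval m : ℤ) : ℂ) := by
    rw [← eq_intCast (algebraMap ℤ ℂ) m, eval_map_algebraMap, aeval_algebraMap_apply]
    simp
  rw [h2, Complex.norm_intCast] at h1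
  exact (le_self_pow₀ ht hd).trans h1

/-- A monic integer polynomial is irreducible if it takes a value `± s * q` with `q` prime at an
integer whose distance to every complex root exceeds `s`. -/
theorem irreducible_of_eval_eq {Q : ℤ[X]} (hQ : Q.Monic) (hd : Q.natDegree ≠ 0) {m : ℤ}
    {s q : ℕ} (hs : 0 < s) (hq : q.Prime) {t : ℝ} (hst : s < t)
    (h : ∀ z : ℂ, aeval z Q = 0 → t ≤ ‖(m : ℂ) - z‖) (he : (Q.eval m).natAbs = s * q) :
    Irreducible Q := by
  have ht : 1 ≤ t := le_trans (by exact_mod_cast hs) hst.le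
  have key : ∀ f g : ℤ[X], f.Monic → f * g = Q → f.natDegree ≠ 0 →
      s < (f.eval m).natAbs := by
    intro f g hf hfg hf0
    have h1 := le_abs_eval_of_roots hf hf0 ht (m := m) fun z hz => h z (by
      rw [← hfg, map_mul, hz, zero_mul])
    have h2 := hst.trans_le h1
    rw [← Int.cast_abs, ← Nat.cast_natAbs] at h2
    exact_mod_cast h2
  refine (hQ.irreducible_iff_natDegree).mpr ⟨?_, fun f g hf hg hfg => ?_⟩
  · rintro rfl; simp at hd
  by_contra! hne
  have h1 := key f g hf hfg hne.1
  have h2 := key g f hg (by rw [mul_comm, hfg]) hne.2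
  have h3 : (f.eval m).natAbs * (g.eval m).natAbs = s * q := by
    rw [← he, ← hfg, eval_mul, Int.natAbs_mul]
  have aux : ∀ x y : ℕ, s < x → s < y → x * y = s * q → ¬ q ∣ x := by
    rintro _ y hx hy hxy ⟨k, rfl⟩
    have hk : k * y = s := by
      have : q * (k * y) = q * s := by rw [← mul_assoc, hxy, mul_comm]
      exact Nat.eq_of_mul_eq_mul_left hq.pos this
    have hk0 : k ≠ 0 := by rintro rfl; simp at hx
    have := Nat.le_mul_of_pos_left y (Nat.pos_of_ne_zero hk0)
    omega
  rcases (hq.dvd_mul).mp (h3 ▸ Dvd.intro_left s rfl) with h4 | h4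
  · exact aux _ _ h1 h2 h3 h4
  · exact aux _ _ h2 h1 (by rw [mul_comm, h3]) h4

theorem norm_le_of_sum_pow_eq {d : ℕ} {z : ℂ} {c : ℤ} {R : ℝ} (hR : 1 ≤ R)
    (hc : 2 * |(c : ℝ)| + 1 ≤ R ^ (d + 1)) (h : ∑ i ∈ range (d + 2), z ^ i = c) : ‖z‖ ≤ R := by
  by_contra! hz
  have h1 : z ^ (d + 2) = 1 + c * (z - 1) := by
    have := geom_sum_mul z (d + 2)
    rw [h] at this
    linear_combination -this
  have h2 : ‖z‖ ^ (d + 2) ≤ 1 + |(c : ℝ)| * (‖z‖ + 1) := by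
    rw [← norm_pow, h1]
    refine (norm_add_le _ _).trans ?_
    rw [norm_one, norm_mul, Complex.norm_intCast]
    have := norm_sub_le z 1
    rw [norm_one] at this
    gcongr
  have h3 : R ^ (d + 1) < ‖z‖ ^ (d + 1) := by gcongr
  have h4 : (2 * |(c : ℝ)| + 1) * ‖z‖ < ‖z‖ ^ (d + 1) * ‖z‖ := by
    have : 0 < ‖z‖ := by linarith
    gcongr; linarith
  rw [← pow_succ] at h4
  nlinarith [abs_nonneg (c : ℝ)]

theorem exists_sum_X_pow_sub_eq_mul (d : ℕ) {r c : ℤ} (hc : ∑ i ∈ range (d + 2), r ^ i = c) :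
    ∃ Q : ℤ[X], Q.Monic ∧ Q.natDegree = d ∧ ∑ i ∈ range (d + 2), X ^ i - C c = (X - C r) * Q := by
  set P : ℤ[X] := ∑ i ∈ range (d + 2), X ^ i - C c with hP
  have hlow : (∑ i ∈ range (d + 1), X ^ i - C c : ℤ[X]).degree < ((d + 1 : ℕ) : WithBot ℕ) := by
    refine (degree_sub_le _ _).trans_lt (max_lt ?_ ?_)
    · refine (degree_sum_le _ _).trans_lt ((Finset.sup_lt_iff (WithBot.bot_lt_coe _)).mpr ?_)
      intro i hi
      rw [degree_X_pow]
      exact_mod_cast Finset.mem_range.mp hi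
    · exact degree_C_le.trans_lt (by exact_mod_cast d.succ_pos)
  have hP' : P = X ^ (d + 1) + (∑ i ∈ range (d + 1), X ^ i - C c) := by
    rw [hP, sum_range_succ]; ring
  have hPm : P.Monic := hP' ▸ monic_X_pow_add hlow
  have hPd : P.natDegree = d + 1 := by
    rw [hP', natDegree_add_eq_left_of_degree_lt (by rwa [degree_X_pow]), natDegree_X_pow]
  obtain ⟨Q, hQ⟩ : X - C r ∣ P := by
    rw [dvd_iff_isRoot, IsRoot, hP, eval_sub, eval_finsetSum]
    simp [hc]
  have hQm : Q.Monic := (monic_X_sub_C r).of_mul_monic_left (hQ ▸ hPm)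
  refine ⟨Q, hQm, ?_, hQ⟩
  rw [hQ, (monic_X_sub_C r).natDegree_mul hQm, natDegree_X_sub_C] at hPd
  omega

theorem eventually_factorial_ne_of_eval {d : ℕ} (hd : 2 ≤ d) (r : ℤ) {c : ℤ} (m : ℤ) (s : ℕ) {q : ℕ}
    (hc : ∑ i ∈ range (d + 2), r ^ i = c) (hR : 2 * |c| + 1 ≤ (|r| + 1) ^ (d + 1)) (hs : 0 < s)
    (hm : s + |r| + 1 < |m|) (hq : q.Prime)
    (h : |∑ i ∈ range (d + 2), m ^ i - c| = s * q * |m - r|) :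
    ∀ᶠ n : ℕ in atTop, ∀ b : ℤ, 2 ≤ b → (n.factorial : ℤ) ≠ ∑ i ∈ range (d + 2), b ^ i - c := by
  obtain ⟨Q, hQ, rfl, hP⟩ := exists_sum_X_pow_sub_eq_mul d hc
  have heval : ∀ b : ℤ, ∑ i ∈ range (Q.natDegree + 2), b ^ i - c = (b - r) * Q.eval b := fun b => by
    simpa [eval_finsetSum] using congrArg (eval b) hP
  have hmr : |m - r| ≠ 0 := by
    rw [abs_ne_zero, sub_ne_zero]; rintro rfl; omega
  refine eventually_factorial_ne hQ ?_ hd r c heval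
  refine irreducible_of_eval_eq hQ (by omega) (m := m) (t := |m| - (|r| + 1)) hs hq ?_
    (fun z hz => ?_) ?_
  · have : (s : ℝ) + |r| + 1 < |m| := by exact_mod_cast hm
    push_cast at this ⊢; linarith
  · have hz' : ∑ i ∈ range (Q.natDegree + 2), z ^ i = c := by
      have := congrArg (aeval z) hP
      rw [map_mul, hz, mul_zero] at this
      simpa [sub_eq_zero] using this
    have h1 := norm_le_of_sum_pow_eq (R := |(r : ℝ)| + 1) (by linarith [abs_nonneg (r : ℝ)])
      (by exact_mod_cast hR) hz'
    have h2 := norm_sub_norm_le (m : ℂ) z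
    rw [Complex.norm_intCast] at h2
    push_cast; linarith
  · have h1 := heval m ▸ h
    rw [abs_mul, mul_comm, mul_left_inj' hmr, Int.abs_eq_natAbs] at h1
    exact_mod_cast h1

end Irreducibility

section ExceptionalPairs

open Filter Topology Finset Polynomial

/-- The polynomial `((X + 1) ^ p - 1 - p X) / X ^ 2`. -/
noncomputable def binomialTail (p : ℕ) : ℤ[X] :=
  ∑ j ∈ range (p - 1), C (p.choose (j + 2) : ℤ) * X ^ j

theorem coeff_binomialTail (p i : ℕ) :
    (binomialTail p).coeff i = if i < p - 1 then (p.choose (i + 2) : ℤ) else 0 := by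
  simp [binomialTail, finsetSum_coeff, coeff_X_pow]

theorem natDegree_binomialTail (d : ℕ) : (binomialTail (d + 2)).natDegree = d := by
  refine natDegree_eq_of_le_of_coeff_ne_zero ?_ ?_
  · rw [natDegree_le_iff_coeff_eq_zero]
    intro i hi
    rw [coeff_binomialTail, if_neg (by omega)]
  · simp [coeff_binomialTail]

theorem monic_binomialTail (d : ℕ) : (binomialTail (d + 2)).Monic := by
  rw [Monic, leadingCoeff, natDegree_binomialTail, coeff_binomialTail]
  simp

theorem irreducible_binomialTail {d : ℕ} (hd : 1 ≤ d) (hp : (d + 2).Prime) :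
    Irreducible (binomialTail (d + 2)) := by
  have hprime : Prime ((d + 2 : ℕ) : ℤ) := Nat.prime_iff_prime_int.mp hp
  have hP : (Ideal.span {((d + 2 : ℕ) : ℤ)}).IsPrime :=
    (Ideal.span_singleton_prime hprime.ne_zero).mpr hprime
  have hm := monic_binomialTail d
  refine (hm.isEisensteinAt_of_mem_of_notMem hP.ne_top (fun {i} hi => ?_) ?_).irreducible hP
    hm.isPrimitive (by rwa [natDegree_binomialTail])
  · rw [natDegree_binomialTail] at hi
    rw [coeff_binomialTail, if_pos (by omega), Ideal.mem_span_singleton, Int.natCast_dvd_natCast]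
    exact hp.dvd_choose_self (by omega) (by omega)
  · rw [coeff_binomialTail, if_pos (by omega), Ideal.span_singleton_pow, Ideal.mem_span_singleton]
    intro h
    have h1 : (d + 2) ^ 2 ∣ (d + 2).choose 2 := by exact_mod_cast h
    have h2 := Nat.le_of_dvd (Nat.choose_pos (by omega)) h1
    rw [Nat.choose_two_right] at h2
    have h3 := Nat.div_le_self ((d + 2) * (d + 2 - 1)) 2
    have h4 : (d + 2) * (d + 2 - 1) < (d + 2) ^ 2 := by
      rw [pow_two]; exact Nat.mul_lt_mul_of_pos_left (by omega) (by omega)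
    omega

theorem sum_pow_sub_eq_mul_binomialTail (d : ℕ) (b : ℤ) :
    ∑ i ∈ range (d + 2), b ^ i - ((d + 2 : ℕ) : ℤ) =
      (b - 1) * ((binomialTail (d + 2)).comp (X - C 1)).eval b := by
  rcases eq_or_ne b 1 with rfl | hb
  · simp
  refine mul_right_cancel₀ (sub_ne_zero.mpr hb) ?_
  have h1 := geom_sum_mul b (d + 2)
  have h2 := add_pow (b - 1) 1 (d + 2)
  rw [sum_range_succ', sum_range_succ'] at h2
  have h3 : eval (b - 1) (binomialTail (d + 2)) * (b - 1) * (b - 1) =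
      ∑ k ∈ range (d + 1), (b - 1) ^ (k + 1 + 1) * 1 ^ (d + 2 - (k + 1 + 1)) *
        ((d + 2).choose (k + 1 + 1) : ℤ) := by
    rw [binomialTail, eval_finsetSum, sum_mul, sum_mul]
    refine sum_congr rfl fun k _ => ?_
    simp only [eval_mul, eval_C, eval_pow, eval_X, one_pow]
    ring
  rw [← h3] at h2
  simp only [sub_add_cancel, zero_add, pow_one, one_pow, mul_one, Nat.choose_one_right, pow_zero,
    Nat.choose_zero_right, Nat.cast_one] at h2
  rw [eval_comp, eval_sub, eval_X, eval_C, sub_mul, h1, h2]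
  ring

theorem eventually_factorial_ne_sub_prime {p : ℕ} (hp : p.Prime) (h4 : 4 ≤ p) :
    ∀ᶠ n : ℕ in atTop, ∀ b : ℤ, 2 ≤ b → (n.factorial : ℤ) ≠ ∑ i ∈ range p, b ^ i - p := by
  obtain ⟨d, rfl⟩ : ∃ d, p = d + 2 := ⟨p - 2, by omega⟩
  set Q : ℤ[X] := (binomialTail (d + 2)).comp (X - C 1) with hQ
  have hdeg : Q.natDegree = d := by
    rw [hQ, natDegree_comp, natDegree_binomialTail, natDegree_X_sub_C, mul_one]
  have hm : Q.Monic := (monic_binomialTail d).comp_X_sub_C 1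
  have hirr : Irreducible Q := by
    have h := (MulEquiv.irreducible_iff (algEquivAevalXAddC (-1 : ℤ))).mpr
      (irreducible_binomialTail (by omega) hp)
    rwa [algEquivAevalXAddC_apply, ← comp_eq_aeval, C_neg, ← sub_eq_add_neg] at h
  have := eventually_factorial_ne hm hirr (by omega) 1 ((d + 2 : ℕ) : ℤ)
  rw [hdeg] at this
  exact this (sum_pow_sub_eq_mul_binomialTail d)

/-- The remainder of `a ^ e` modulo `q`, for exponents of at most `k` bits, by repeated squaring. -/
def powMod (q : ℕ) : ℕ → ℕ → ℕ → ℕ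
  | 0, _, _ => 1 % q
  | k + 1, a, e => powMod q k (a ^ 2 % q) (e / 2) * a ^ (e % 2) % q

theorem powMod_eq (q : ℕ) {k : ℕ} (a : ℕ) {e : ℕ} (he : e < 2 ^ k) :
    powMod q k a e = a ^ e % q := by
  induction k generalizing a e with
  | zero =>
    obtain rfl : e = 0 := by simpa using he
    rfl
  | succ k ih =>
    rw [powMod, ih _ (by omega), Nat.mod_mul_mod, Nat.mul_mod, ← Nat.pow_mod, ← Nat.mul_mod,
      ← pow_mul, ← pow_add, Nat.div_add_mod]

/-- **Lucas's primality test**, with all exponentiations performed on natural numbers. -/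
theorem prime_of_powMod {q : ℕ} (k a : ℕ) (L : List ℕ) (hq : 1 < q) (hqk : q ≤ 2 ^ k)
    (hL : ∀ f ∈ L, f.Prime) (hprod : L.prod = q - 1) (h1 : powMod q k a (q - 1) = 1)
    (h2 : L.all (fun f => powMod q k a ((q - 1) / f) != 1) = true) : q.Prime := by
  have key : ∀ e ≤ q - 1, (a : ZMod q) ^ e = 1 ↔ powMod q k a e = 1 := fun e he => by
    rw [powMod_eq q a (by omega), ← Nat.cast_pow, ← Nat.cast_one, ZMod.natCast_eq_natCast_iff',
      Nat.mod_eq_of_lt hq]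
  refine lucas_primality q a ((key _ le_rfl).mpr h1) fun f hf hfd => ?_
  rw [Ne, key _ (Nat.div_le_self _ _)]
  rw [← hprod] at hfd
  obtain ⟨g, hg, hfg⟩ := (Prime.dvd_prod_iff hf.prime).mp hfd
  have := List.all_eq_true.mp h2 g hg
  rw [← (Nat.prime_dvd_prime_iff_eq hf (hL g hg)).mp hfg] at this
  simpa using this

set_option maxRecDepth 10000

theorem prime_1136363551 : Nat.Prime 1136363551 :=
  prime_of_powMod 31 3 [2, 3, 5, 5, 7, 29, 67, 557] (by norm_num) (by norm_num)
    (by norm_num) (by norm_num) rfl rfl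

theorem prime_115374670783 : Nat.Prime 115374670783 :=
  prime_of_powMod 37 3 [2, 3, 7, 7, 23, 17062211] (by norm_num) (by norm_num)
    (by norm_num) (by norm_num) rfl rfl

theorem prime_1356861614900758301 : Nat.Prime 1356861614900758301 :=
  prime_of_powMod 61 3 [2, 2, 5, 5, 2659, 5147, 26113, 37967] (by norm_num) (by norm_num)
    (by norm_num) (by norm_num) rfl rfl

theorem prime_23336430419 : Nat.Prime 23336430419 :=
  prime_of_powMod 35 2 [2, 7, 7, 31, 7681511] (by norm_num) (by norm_num)
    (by norm_num) (by norm_num) rfl rfl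

theorem prime_28550288800618823215969 : Nat.Prime 28550288800618823215969 :=
  prime_of_powMod 75 7 [2, 2, 2, 2, 2, 3, 1297, 9825731, 23336430419] (by norm_num) (by norm_num)
    (by
    simp only [List.forall_mem_cons]
    exact ⟨by norm_num, by norm_num, by norm_num, by norm_num, by norm_num, by norm_num,
      by norm_num, by norm_num, prime_23336430419, by simp⟩) (by norm_num) rfl rfl

theorem prime_12363598669 : Nat.Prime 12363598669 :=
  prime_of_powMod 34 2 [2, 2, 3, 101, 2351, 4339] (by norm_num) (by norm_num)
    (by norm_num) (by norm_num) rfl rfl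

theorem prime_138812610109 : Nat.Prime 138812610109 :=
  prime_of_powMod 38 10 [2, 2, 3, 82139, 140831] (by norm_num) (by norm_num)
    (by norm_num) (by norm_num) rfl rfl

theorem eventually_factorial_ne_sub_8191 :
    ∀ᶠ n : ℕ in atTop, ∀ b : ℤ, 2 ≤ b → (n.factorial : ℤ) ≠ ∑ i ∈ range 11, b ^ i - 8191 := by
  filter_upwards [eventually_ge_atTop 11] with n hn b _ h
  have h1 : (11 : ℕ) ∣ n.factorial := Nat.dvd_factorial (by norm_num) hn
  have h2 : ∀ x : ZMod 11, (0 : ZMod 11) ≠ ∑ i ∈ range 11, x ^ i - 8191 := by decide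
  refine h2 b ?_
  rw [← (ZMod.natCast_eq_zero_iff n.factorial 11).mpr h1]
  exact_mod_cast congrArg (Int.cast : ℤ → ZMod 11) h

theorem eventually_factorial_ne_add {a : ℤ} {p : ℕ} (h : (a, p) ∈ S₀) :
    ∀ᶠ n : ℕ in atTop, ∀ b : ℤ, 2 ≤ b → (n.factorial : ℤ) ≠ ∑ i ∈ range p, b ^ i + a := by
  rcases h with ⟨q, hq, h7, -, hx⟩ | h
  · obtain ⟨rfl, rfl⟩ := Prod.mk.inj hx
    exact eventually_factorial_ne_sub_prime hq (by omega)
  · simp only [Set.mem_insert_iff, Set.mem_singleton_iff, Prod.mk.injEq] at h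
    rcases h with ⟨rfl, rfl⟩ | ⟨rfl, rfl⟩ | ⟨rfl, rfl⟩ | ⟨rfl, rfl⟩ | ⟨rfl, rfl⟩ | ⟨rfl, rfl⟩ |
      ⟨rfl, rfl⟩ | ⟨rfl, rfl⟩ | ⟨rfl, rfl⟩ | ⟨rfl, rfl⟩ | ⟨rfl, rfl⟩ | ⟨rfl, rfl⟩ |
      ⟨rfl, rfl⟩ | ⟨rfl, rfl⟩ | ⟨rfl, rfl⟩ | ⟨rfl, rfl⟩ | ⟨rfl, rfl⟩
    · exact eventually_factorial_ne_of_eval (d := 5) (by norm_num) (-2) (c := 43) 12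
        3 (q := 77557) (by decide) (by norm_num) (by norm_num)
        (by norm_num) (by norm_num) (by decide)
    · exact eventually_factorial_ne_of_eval (d := 5) (by norm_num) 2 (c := 127) (-30)
        21 (q := 1049827) (by decide) (by norm_num) (by norm_num)
        (by norm_num) (by norm_num) (by decide)
    · exact eventually_factorial_ne_of_eval (d := 5) (by norm_num) (-3) (c := 547) (-21)
        7 (q := 649739) (by decide) (by norm_num) (by norm_num)
        (by norm_num) (by norm_num) (by decide)
    · exact eventually_factorial_ne_of_eval (d := 9) (by norm_num) (-2) (c := 683) (-10)
        1 (q := 1136363551) (by decide) (by norm_num) (by norm_num)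
        (by norm_num) prime_1136363551 (by decide)
    · exact eventually_factorial_ne_of_eval (d := 5) (by norm_num) 3 (c := 1093) (-11)
        3 (q := 38639) (by decide) (by norm_num) (by norm_num)
        (by norm_num) (by norm_num) (by decide)
    · exact eventually_factorial_ne_of_eval (d := 9) (by norm_num) 2 (c := 2047) (-21)
        6 (q := 115374670783) (by decide) (by norm_num) (by norm_num)
        (by norm_num) prime_115374670783 (by decide)
    · exact eventually_factorial_ne_of_eval (d := 11) (by norm_num) (-2) (c := 2731) (-62)
        39 (q := 1356861614900758301) (by decide) (by norm_num) (by norm_num)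
        (by norm_num) prime_1356861614900758301 (by decide)
    · exact eventually_factorial_ne_of_eval (d := 5) (by norm_num) (-4) (c := 3277) 22
        15 (q := 304553) (by decide) (by norm_num) (by norm_num)
        (by norm_num) (by norm_num) (by decide)
    · exact eventually_factorial_ne_of_eval (d := 5) (by norm_num) 4 (c := 5461) 18
        3 (q := 857321) (by decide) (by norm_num) (by norm_num)
        (by norm_num) (by norm_num) (by decide)
    · exact eventually_factorial_ne_sub_8191
    · exact eventually_factorial_ne_of_eval (d := 5) (by norm_num) (-5) (c := 13021) 22
        6 (q := 733123) (by decide) (by norm_num) (by norm_num)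
        (by norm_num) (by norm_num) (by decide)
    · exact eventually_factorial_ne_of_eval (d := 5) (by norm_num) 5 (c := 19531) (-29)
        21 (q := 805289) (by decide) (by norm_num) (by norm_num)
        (by norm_num) (by norm_num) (by decide)
    · exact eventually_factorial_ne_of_eval (d := 5) (by norm_num) (-6) (c := 39991) (-17)
        6 (q := 344797) (by decide) (by norm_num) (by norm_num)
        (by norm_num) (by norm_num) (by decide)
    · exact eventually_factorial_ne_of_eval (d := 15) (by norm_num) (-2) (c := 43691) 38
        17 (q := 28550288800618823215969) (by decide) (by norm_num) (by norm_num)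
        (by norm_num) prime_28550288800618823215969 (by decide)
    · exact eventually_factorial_ne_of_eval (d := 9) (by norm_num) (-3) (c := 44287) (-17)
        11 (q := 12363598669) (by decide) (by norm_num) (by norm_num)
        (by norm_num) prime_12363598669 (by decide)
    · exact eventually_factorial_ne_of_eval (d := 5) (by norm_num) 6 (c := 55987) (-15)
        4 (q := 126461) (by decide) (by norm_num) (by norm_num)
        (by norm_num) (by norm_num) (by decide)
    · exact eventually_factorial_ne_of_eval (d := 9) (by norm_num) 3 (c := 88573) (-23)
        11 (q := 138812610109) (by decide) (by norm_num) (by norm_num)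
        (by norm_num) prime_138812610109 (by decide)

theorem finite_S₀ : S₀.Finite := by
  refine Set.Finite.union (((range 100001).finite_toSet.image fun p : ℕ => (-(p : ℤ), p)).subset ?_)
    (Set.toFinite _)
  rintro x ⟨p, -, -, hp, rfl⟩
  exact ⟨p, by simpa using Nat.lt_succ_of_le hp, rfl⟩

end ExceptionalPairs

/-- **Theorem 2 (vi).** There exists a positive integer `n₀` such that for all
integers `n ≥ n₀` and `b ≥ 2` and every pair `(a, p) ∈ S₀`, if
`n! = (b^p − 1)/(b − 1) + a`, then `|a| ≥ 0.5·(log log log n)/(log log log log n)`. -/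
theorem thm2_part6 :
    ∃ n₀ : ℕ, 0 < n₀ ∧ ∀ (n : ℕ) (b : ℤ) (a : ℤ) (p : ℕ),
      n₀ ≤ n → 2 ≤ b → (a, p) ∈ S₀ →
      (Nat.factorial n : ℤ) = (∑ i ∈ Finset.range p, b ^ i) + a →
      0.5 * Real.log (Real.log (Real.log n)) /
          Real.log (Real.log (Real.log (Real.log n))) ≤ |(a : ℝ)| := by
  have h := (Filter.eventually_all_finite finite_S₀).mpr fun x hx => eventually_factorial_ne_add hx
  obtain ⟨N, hN⟩ := Filter.eventually_atTop.mp h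
  exact ⟨N + 1, N.succ_pos, fun n b a p hn hb hS hf =>
    absurd hf (hN n (by omega) (a, p) hS b hb)⟩
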